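/- arXiv:2403.19642 — 6 statements merged into one kernel-verified Lean document; each statement's English description precedes it below -/
import Mathlib

section
/- Let q be an odd prime power, let f ∈ F_q[x] have degree d ≥ 2, and suppose f is NOT of any of the following forms: (a) f = A(x−B)^{p^e} with A,B ∈ F_q, e ≥ 1, where p = char(F_q); (b) f = A·g² with A ∈ F_q, g ∈ F_q[x]; (c) f = A·x·g² with A ∈ F_q, g ∈ F_q[x]; (d) f = A·h² + B where A,B ∈ F_q, A ≠ 0, n = d/2, and h = Σ_{i=0}^{n} a_i x^i ∈ F_q[x] of degree n satisfies A·a_0² + B = 0 and i(2i−1)B·a_i = −2(n+i−1)(n−i+1)·a_{i−1} for all i ∈ {1,…,n}; (e) f = A(x−B)·g² where A,B ∈ F_q, A ≠ 0, n = (d−1)/2, and g = Σ_{i=0}^{n} a_i x^i ∈ F_q[x] of degree n satisfies A·a_0² = −1 and i(2i−1)B·a_i = −2(n−i+1)(n+i)·a_{i−1} for all i ∈ {1,…,n}. Then there exists a constant C > 0 depending only on d with the following property: for every a ∈ F_q, if the sequence (χ(f^n(a)))_{n≥0} is periodic with period m, then |O_f(a)| ≤ C · m · q^{(2·log₂(d)+1)/(2·log₂(d)+2)}.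 -/
open Polynomial

/-- The `n`-th iterate of a polynomial under composition, with `f^0 = X`. -/
noncomputable def polyIter {K : Type*} [CommRing K] (f : K[X]) : ℕ → K[X]
  | 0 => X
  | n + 1 => f.comp (polyIter f n)

/-- `f` is dynamically 2-ordinary: for every `n ≥ 1` there is an irreducible factor of `f^n`
with odd multiplicity in `f^n` that does not divide `f^i` for any `i < n`. -/
def DynTwoOrdinary {K : Type*} [Field K] (f : K[X]) : Prop :=
  ∀ n : ℕ, 1 ≤ n → ∃ g : K[X], Irreducible g ∧
    (∃ e : ℕ, Odd e ∧ g ^ e ∣ polyIter f n ∧ ¬ g ^ (e + 1) ∣ polyIter f n) ∧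
    ∀ i : ℕ, i < n → ¬ g ∣ polyIter f i

/-- The five exceptional forms (a)–(e) of the classification theorem, where `p = ringChar F`
and `d = f.natDegree`. -/
def ExceptionalForm {F : Type*} [Field F] (f : F[X]) : Prop :=
  -- (a) `f = A(x−B)^{p^e}`
  (∃ A B : F, ∃ e : ℕ, 1 ≤ e ∧ f = C A * (X - C B) ^ (ringChar F ^ e)) ∨
  -- (b) `f = A·g²`
  (∃ A : F, ∃ g : F[X], f = C A * g ^ 2) ∨
  -- (c) `f = A·x·g²`
  (∃ A : F, ∃ g : F[X], f = C A * X * g ^ 2) ∨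
  -- (d) `f = A·h² + B` with `h` of degree `n = d/2` satisfying the recurrence
  (∃ A B : F, A ≠ 0 ∧ ∃ h : F[X], h.natDegree = f.natDegree / 2 ∧
    f = C A * h ^ 2 + C B ∧ A * h.coeff 0 ^ 2 + B = 0 ∧
    ∀ i : ℕ, 1 ≤ i → i ≤ f.natDegree / 2 →
      (((i : ℤ) * (2 * (i : ℤ) - 1) : ℤ) : F) * B * h.coeff i =
        ((-(2 * (((f.natDegree / 2 : ℕ) : ℤ) + (i : ℤ) - 1) *
            (((f.natDegree / 2 : ℕ) : ℤ) - (i : ℤ) + 1)) : ℤ) : F) * h.coeff (i - 1)) ∨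
  -- (e) `f = A(x−B)·g²` with `g` of degree `n = (d−1)/2` satisfying the recurrence
  (∃ A B : F, A ≠ 0 ∧ ∃ g : F[X], g.natDegree = (f.natDegree - 1) / 2 ∧
    f = C A * (X - C B) * g ^ 2 ∧ A * g.coeff 0 ^ 2 = -1 ∧
    ∀ i : ℕ, 1 ≤ i → i ≤ (f.natDegree - 1) / 2 →
      (((i : ℤ) * (2 * (i : ℤ) - 1) : ℤ) : F) * B * g.coeff i =
        ((-(2 * ((((f.natDegree - 1) / 2 : ℕ) : ℤ) - (i : ℤ) + 1) *
            ((((f.natDegree - 1) / 2 : ℕ) : ℤ) + (i : ℤ))) : ℤ) : F) * g.coeff (i - 1))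

open Classical in
/-- The quadratic character of a field: `χ(0) = 0`, `χ(x) = 1` if `x` is a nonzero square,
`χ(x) = −1` otherwise. -/
noncomputable def chi {F : Type*} [Field F] (x : F) : ℤ :=
  if x = 0 then 0 else if IsSquare x then 1 else -1



lemma hd_pow {F : Type*} [Field F] (g : F[X]) (hg : g ≠ 0) (N : ℕ) : ∀ b : ℕ, ∃ w : F[X],
    g ^ b * hasseDeriv b (g ^ N) = g ^ N * w ∧ w.natDegree ≤ b * g.natDegree := by
  have key : ∀ b : ℕ, ∃ w : F[X], g ^ b * hasseDeriv b (g ^ N) = g ^ N * w := by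
    induction N with
    | zero => intro b; exact ⟨g ^ b * hasseDeriv b 1, by simp⟩
    | succ N ih =>
      intro b
      choose w hw using ih
      have : g ^ (N+1) ∣ g ^ b * hasseDeriv b (g ^ (N+1)) := by
        rw [pow_succ' g N, hasseDeriv_mul, Finset.mul_sum]
        apply Finset.dvd_sum
        rintro ⟨i, j⟩ hij
        rw [Finset.HasAntidiagonal.mem_antidiagonal] at hij
        simp only at hij ⊢
        subst hij
        have h1 : g ^ (i + j) * ((hasseDeriv i) g * (hasseDeriv j) (g ^ N))
          = (g ^ i * hasseDeriv i g) * (g ^ N * w j) := by rw [← hw j]; ring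
        rw [h1]
        have h2 : g ∣ g ^ i * hasseDeriv i g := by
          rcases Nat.eq_zero_or_pos i with h | h
          · subst h; simp
          · exact Dvd.dvd.mul_right (dvd_pow_self g h.ne') _
        exact mul_dvd_mul h2 (Dvd.intro _ rfl)
      obtain ⟨c, hc⟩ := this
      exact ⟨c, hc⟩
  intro b
  obtain ⟨w, hw⟩ := key b
  refine ⟨w, hw, ?_⟩
  by_cases hw0 : w = 0
  · simp [hw0]
  have h1 : (g ^ N * w).natDegree = N * g.natDegree + w.natDegree := by
    rw [natDegree_mul (pow_ne_zero _ hg) hw0, natDegree_pow]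
  have h2 : (g ^ b * hasseDeriv b (g ^ N)).natDegree ≤ b * g.natDegree + N * g.natDegree := by
    refine natDegree_mul_le.trans ?_
    have := natDegree_hasseDeriv_le (g ^ N) b
    rw [natDegree_pow] at this ⊢
    omega
  rw [hw, h1] at h2
  omega

lemma hd_L {F : Type*} [Field F] (g : F[X]) (hg : g ≠ 0) (N l : ℕ) : ∃ L : F[X] →ₗ[F] F[X],
    ∀ k : F[X], g ^ l * hasseDeriv l (k * g ^ N) = g ^ N * L k ∧
      (L k).natDegree ≤ k.natDegree + l * g.natDegree := by
  choose w hw hwd using hd_pow g hg N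
  refine ⟨∑ ij ∈ Finset.HasAntidiagonal.antidiagonal l, (LinearMap.mulLeft F (g ^ ij.1 * w ij.2)) ∘ₗ hasseDeriv ij.1, ?_⟩
  intro k
  constructor
  · rw [hasseDeriv_mul, Finset.mul_sum, LinearMap.sum_apply, Finset.mul_sum]
    apply Finset.sum_congr rfl
    rintro ⟨i, j⟩ hij
    rw [Finset.HasAntidiagonal.mem_antidiagonal] at hij
    simp only at hij ⊢
    subst hij
    simp only [LinearMap.comp_apply, LinearMap.mulLeft_apply]
    linear_combination (g ^ i * hasseDeriv i k) * hw j
  · rw [LinearMap.sum_apply]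
    apply natDegree_sum_le_of_forall_le
    rintro ⟨i, j⟩ hij
    rw [Finset.HasAntidiagonal.mem_antidiagonal] at hij
    simp only at hij ⊢
    subst hij
    simp only [LinearMap.comp_apply, LinearMap.mulLeft_apply]
    refine natDegree_mul_le.trans ?_
    have h1 := natDegree_hasseDeriv_le k i
    have h2 : (g ^ i * w j).natDegree ≤ _ := natDegree_mul_le
    rw [natDegree_pow] at h2
    have h3 := hwd j
    rw [add_mul]
    omega

lemma hd_frob {F : Type*} [Field F] [Fintype F] (P : F[X]) (l j : ℕ) (hl : l < Fintype.card F) :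
    hasseDeriv l (P * X ^ (Fintype.card F * j)) = hasseDeriv l P * X ^ (Fintype.card F * j) := by
  rw [hasseDeriv_mul, Finset.sum_eq_single (l, 0)]
  · simp
  · rintro ⟨a, b⟩ hab hne
    rw [Finset.HasAntidiagonal.mem_antidiagonal] at hab
    simp only at hab ⊢
    have hb : b ≠ 0 := by rintro rfl; apply hne; simpa using hab
    have : ((Nat.choose (Fintype.card F * j) b : ℕ) : F) = 0 := by
      rw [← coeff_one_add_X_pow, mul_comm, pow_mul, ← FiniteField.expand_card, coeff_expand Fintype.card_pos, if_neg]
      intro h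
      have := Nat.le_of_dvd (Nat.pos_of_ne_zero hb) h
      omega
    rw [X_pow_eq_monomial, hasseDeriv_monomial, this]
    simp
  · intro h; simp at h

lemma exists_ker {F : Type*} [Field F] {ι : Type*} [Fintype ι] (M E : ℕ) (W : ℕ → ((ι → F) →ₗ[F] F[X]))
    (hW : ∀ l < M, ∀ v, (W l v).natDegree < E) (h : M * E < Fintype.card ι) :
    ∃ v : ι → F, v ≠ 0 ∧ ∀ l < M, W l v = 0 := by
  let Φ : (ι → F) →ₗ[F] (Fin M × Fin E → F) :=
    LinearMap.pi fun x => (lcoeff F x.2) ∘ₗ W x.1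
  have hΦ : LinearMap.ker Φ ≠ ⊥ := Φ.ker_ne_bot_of_finrank_lt (by simpa using h)
  obtain ⟨v, hv, hv0⟩ := (Submodule.ne_bot_iff _).1 hΦ
  refine ⟨v, hv0, fun l hl => ?_⟩
  ext i
  by_cases hi : i < E
  · have := congrFun (LinearMap.mem_ker.1 hv) (⟨l, hl⟩, ⟨i, hi⟩)
    simpa [Φ] using this
  · rw [coeff_eq_zero_of_natDegree_lt, coeff_zero]
    have := hW l hl v; omega

/-- not a constant times a square -/
def NotSq {F : Type*} [Field F] (g : F[X]) : Prop := ∀ (c : F) (h : F[X]), g ≠ C c * h ^ 2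

lemma notSq_aux {F : Type*} [Field F] (g u v : F[X]) (c : F) (hg : NotSq g) (hu : u ≠ 0)
    (h : u ^ 2 * g = C c * v ^ 2) : False := by
  by_cases hc : c = 0
  · subst hc
    have : g = 0 := by simpa [hu] using h
    exact hg 0 0 (by simp [this])
  have hdvd : u ^ 2 ∣ v ^ 2 := by
    have : v ^ 2 = u ^ 2 * (C c⁻¹ * g) := by
      have h2 : C c⁻¹ * (C c * v ^ 2) = v ^ 2 := by
        rw [← mul_assoc, ← C_mul, inv_mul_cancel₀ hc]; simp
      rw [← h2, ← h]; ring
    exact ⟨_, this⟩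
  rw [UniqueFactorizationMonoid.pow_dvd_pow_iff_dvd two_ne_zero] at hdvd
  obtain ⟨w, rfl⟩ := hdvd
  apply hg c w
  have : u ^ 2 * g = u ^ 2 * (C c * w ^ 2) := by rw [h]; ring
  exact mul_left_cancel₀ (pow_ne_zero 2 hu) this


lemma nonvanish {F : Type*} [Field F] [Fintype F] (g : F[X]) (hg : NotSq g) (h0 : g.coeff 0 ≠ 0)
    (c : ℕ) (hq : Fintype.card F = 2 * c + 1) (J : ℕ) : ∀ k0 k1 : Fin J → F[X],
    (∀ j, 2 * (k0 j).natDegree + g.natDegree < Fintype.card F) →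
    (∀ j, 2 * (k1 j).natDegree + g.natDegree < Fintype.card F) →
    ∑ j, (k0 j + k1 j * g ^ c) * X ^ (Fintype.card F * (j : ℕ)) = 0 →
    ∀ j, k0 j = 0 ∧ k1 j = 0 := by
  set q := Fintype.card F with hqdef
  have hexp : ∃ r : F[X], g ^ q = C (g.coeff 0) + X ^ q * r := by
    rw [hqdef, ← FiniteField.expand_card]
    have : X ∣ g - C (g.coeff 0) := by rw [X_dvd_iff]; simp
    obtain ⟨r, hr⟩ := this
    refine ⟨expand F (Fintype.card F) r, ?_⟩
    have h2 : g = C (g.coeff 0) + X * r := by rw [← hr]; ring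
    conv_lhs => rw [h2]
    simp
  obtain ⟨r, hr⟩ := hexp
  induction J with
  | zero => intro _ _ _ _ _ j; exact j.elim0
  | succ J ih =>
    intro k0 k1 hd0 hd1 hs
    rw [Fin.sum_univ_succ] at hs
    have hshift : ∑ i : Fin J, (k0 i.succ + k1 i.succ * g ^ c) * X ^ (q * ((i.succ : Fin (J+1)) : ℕ))
      = X ^ q * ∑ i : Fin J, (k0 i.succ + k1 i.succ * g ^ c) * X ^ (q * (i : ℕ)) := by
      rw [Finset.mul_sum]
      apply Finset.sum_congr rfl
      intro i _
      rw [Fin.val_succ, mul_add, pow_add]; ring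
    rw [hshift] at hs
    set Z := ∑ i : Fin J, (k0 i.succ + k1 i.succ * g ^ c) * X ^ (q * (i : ℕ)) with hZ
    simp only [Fin.val_zero, mul_zero, pow_zero, mul_one] at hs
    have hdvd : X ^ q ∣ k0 0 ^ 2 * g - C (g.coeff 0) * k1 0 ^ 2 := by
      refine ⟨- g * (k0 0 - k1 0 * g ^ c) * Z + r * k1 0 ^ 2, ?_⟩
      have hgq : g ^ q = g * (g ^ c) ^ 2 := by rw [hq]; ring
      rw [hgq] at hr
      have e1 : C (g.coeff 0) = g * (g ^ c) ^ 2 - X ^ q * r := by rw [hr]; ring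
      rw [e1]
      linear_combination (g * (k0 0 - k1 0 * g ^ c)) * hs
    have hz : k0 0 ^ 2 * g - C (g.coeff 0) * k1 0 ^ 2 = 0 := by
      apply eq_zero_of_dvd_of_natDegree_lt hdvd
      rw [natDegree_X_pow]
      have a1 := hd0 0
      have a2 := hd1 0
      refine lt_of_le_of_lt (natDegree_sub_le _ _) (max_lt ?_ ?_)
      · refine lt_of_le_of_lt natDegree_mul_le ?_
        rw [natDegree_pow]; exact a1
      · refine lt_of_le_of_lt (natDegree_C_mul_le _ _) ?_
        rw [natDegree_pow]; omega
    have hk0 : k0 0 = 0 := by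
      by_contra hne
      exact notSq_aux g (k0 0) (k1 0) (g.coeff 0) hg hne (sub_eq_zero.1 hz)
    have hk1 : k1 0 = 0 := by
      rw [hk0] at hz
      simpa [h0] using hz
    have hZ0 : Z = 0 := by
      rw [hk0, hk1] at hs
      simpa using hs
    have := ih (fun i => k0 i.succ) (fun i => k1 i.succ) (fun i => hd0 _) (fun i => hd1 _) hZ0
    intro j
    refine Fin.cases ⟨hk0, hk1⟩ (fun i => this i) j

lemma stepanov {F : Type*} [Field F] [Fintype F] [DecidableEq F] (g : F[X]) (hg : NotSq g)
    (h0 : g.coeff 0 ≠ 0)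
    (c : ℕ) (hq : Fintype.card F = 2 * c + 1) (J K M : ℕ) (hK1 : 1 ≤ K) (hJ1 : 1 ≤ J)
    (hK : 2 * (K - 1) + g.natDegree < Fintype.card F) (hM : M ≤ Fintype.card F)
    (hdim : M * (K + M * g.natDegree + J) < 2 * (J * K)) :
    M * (Finset.univ.filter fun x : F => g.eval x ^ c = 1).card ≤
      (K - 1) + c * g.natDegree + Fintype.card F * (J - 1) := by
  have hg0 : g ≠ 0 := by rintro rfl; simp at h0
  have hcpos : c ≠ 0 := by
    rintro rfl
    have := Fintype.one_lt_card (α := F)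
    omega
  set q := Fintype.card F with hqdef
  let ι := Bool × Fin J × Fin K
  let κ : Bool → Fin J → ((ι → F) →ₗ[F] F[X]) := fun b j =>
    ∑ i : Fin K, (monomial (i : ℕ)) ∘ₗ (LinearMap.proj (b, j, i))
  have hκ : ∀ b j v, κ b j v = ∑ i : Fin K, monomial (i : ℕ) (v (b, j, i)) := by
    intro b j v; simp [κ]
  have hκd : ∀ b j v, (κ b j v).natDegree ≤ K - 1 := by
    intro b j v
    rw [hκ]
    apply natDegree_sum_le_of_forall_le
    intro i _
    refine (natDegree_monomial_le _).trans ?_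
    have := i.2; omega
  have hκc : ∀ b j v (i : Fin K), (κ b j v).coeff i = v (b, j, i) := by
    intro b j v i
    rw [hκ, finsetSum_coeff, Finset.sum_eq_single i]
    · simp
    · intro b _ hb
      rw [coeff_monomial, if_neg]
      intro h; exact hb (Fin.ext h)
    · simp
  choose L hL using hd_L g hg0 c
  let W : ℕ → ((ι → F) →ₗ[F] F[X]) := fun l =>
    ∑ j : Fin J, (LinearMap.mulRight F (X ^ (j : ℕ))) ∘ₗ
      ((LinearMap.mulLeft F (g ^ l)) ∘ₗ (hasseDeriv l) ∘ₗ κ false j + L l ∘ₗ κ true j)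
  have hW : ∀ l v, W l v = ∑ j : Fin J, (g ^ l * hasseDeriv l (κ false j v) + L l (κ true j v)) * X ^ (j : ℕ) := by
    intro l v; simp [W]
  obtain ⟨v, hv0, hv⟩ := exists_ker M (K + M * g.natDegree + J) W (by
    intro l hl v
    rw [hW]
    have hlM : l * g.natDegree ≤ M * g.natDegree := Nat.mul_le_mul_right _ hl.le
    refine lt_of_le_of_lt (natDegree_sum_le_of_forall_le (n := (K - 1) + l * g.natDegree + (J - 1)) _ _ ?_) (by omega)
    intro j _
    refine natDegree_mul_le.trans ?_
    rw [natDegree_X_pow]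
    have hj := j.2
    have : (g ^ l * hasseDeriv l (κ false j v) + L l (κ true j v)).natDegree ≤ (K - 1) + l * g.natDegree := by
      refine natDegree_add_le_of_degree_le ?_ ?_
      · refine natDegree_mul_le.trans ?_
        have h1 := natDegree_hasseDeriv_le (κ false j v) l
        have h2 := hκd false j v
        rw [natDegree_pow]; omega
      · have h1 := (hL l (κ true j v)).2
        have h2 := hκd true j v
        omega
    omega) (by
      simp only [ι, Fintype.card_prod, Fintype.card_bool, Fintype.card_fin]; exact hdim)
  set R : F[X] := ∑ j : Fin J, (κ false j v + κ true j v * g ^ c) * X ^ (q * (j : ℕ)) with hR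
  have hR0 : R ≠ 0 := by
    intro h
    have := nonvanish g hg h0 c hq J (fun j => κ false j v) (fun j => κ true j v)
      (fun j => by have := hκd false j v; show 2 * (κ false j v).natDegree + _ < _; omega)
      (fun j => by have := hκd true j v; show 2 * (κ true j v).natDegree + _ < _; omega) h
    apply hv0
    ext ⟨b, j, i⟩
    rw [← hκc b j v i]
    cases b
    · rw [(this j).1]; simp
    · rw [(this j).2]; simp
  have hRd : R.natDegree ≤ (K - 1) + c * g.natDegree + q * (J - 1) := by
    apply natDegree_sum_le_of_forall_le
    intro j _
    refine natDegree_mul_le.trans ?_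
    rw [natDegree_X_pow]
    have h3 : q * (j : ℕ) ≤ q * (J - 1) := Nat.mul_le_mul_left _ (by have := j.2; omega)
    have h1 := hκd false j v
    have h2 := hκd true j v
    have : (κ false j v + κ true j v * g ^ c).natDegree ≤ (K - 1) + c * g.natDegree := by
      refine natDegree_add_le_of_degree_le (by omega) ?_
      refine natDegree_mul_le.trans ?_
      rw [natDegree_pow]; omega
    omega
  have hroot : ∀ a : F, g.eval a ^ c = 1 → M ≤ R.rootMultiplicity a := by
    intro a ha
    have hga : g.eval a ≠ 0 := by
      intro h; rw [h, zero_pow hcpos] at ha; exact zero_ne_one ha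
    rw [le_rootMultiplicity_iff hR0]
    have hX : X ^ M ∣ taylor a R := by
      rw [X_pow_dvd_iff]
      intro l hl
      rw [taylor_coeff]
      have key : (g ^ l * hasseDeriv l R).eval a = 0 := by
        have e : g ^ l * hasseDeriv l R = ∑ j : Fin J,
          (g ^ l * hasseDeriv l (κ false j v) + g ^ c * L l (κ true j v)) * X ^ (q * (j : ℕ)) := by
          rw [hR, map_sum, Finset.mul_sum]
          apply Finset.sum_congr rfl
          intro j _
          rw [hd_frob _ _ _ (by omega), map_add, ← (hL l _).1]
          ring
        rw [e]
        have e2 := congrArg (eval a) (hv l hl)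
        rw [hW] at e2
        rw [eval_finsetSum] at e2 ⊢
        rw [← eval_zero (x := a), ← e2]
        apply Finset.sum_congr rfl
        intro j _
        simp only [eval_mul, eval_add, eval_pow, eval_X, ha, one_mul]
        rw [pow_mul, FiniteField.pow_card]
      rw [eval_mul, eval_pow] at key
      exact (mul_eq_zero.1 key).resolve_left (pow_ne_zero _ hga)
    obtain ⟨Q, hQ⟩ := hX
    refine ⟨taylor (-a) Q, ?_⟩
    have := congrArg (taylor (-a)) hQ
    rw [taylor_taylor, neg_add_cancel, taylor_zero, taylor_mul, taylor_pow, taylor_X] at this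
    rw [this]; simp [sub_eq_add_neg]
  calc M * (Finset.univ.filter fun x : F => g.eval x ^ c = 1).card
      = ∑ x ∈ Finset.univ.filter (fun x : F => g.eval x ^ c = 1), M := by simp [mul_comm]
    _ ≤ ∑ x ∈ Finset.univ.filter (fun x : F => g.eval x ^ c = 1), R.roots.count x := by
        apply Finset.sum_le_sum
        intro x hx
        rw [count_roots]
        exact hroot x (by simpa using hx)
    _ ≤ R.roots.card := by
        rw [← Multiset.sum_count_eq_card (s := Finset.univ) (m := R.roots) (fun a _ => Finset.mem_univ a)]
        exact Finset.sum_le_sum_of_subset (Finset.filter_subset _ _)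
    _ ≤ R.natDegree := card_roots' R
    _ ≤ _ := hRd


lemma NotSq.natDegree_pos {F : Type*} [Field F] {g : F[X]} (hg : NotSq g) : 1 ≤ g.natDegree := by
  by_contra h
  have h1 : g.natDegree = 0 := by omega
  rw [natDegree_eq_zero] at h1
  obtain ⟨x, hx⟩ := h1
  exact hg x 1 (by simp [hx])

lemma stepanov_bound0 {F : Type*} [Field F] [Fintype F] [DecidableEq F] (g : F[X]) (hg : NotSq g)
    (h0 : g.coeff 0 ≠ 0) (c : ℕ) (hq : Fintype.card F = 2 * c + 1) :
    ((Finset.univ.filter fun x : F => g.eval x ^ c = 1).card : ℝ) ≤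
      (Fintype.card F : ℝ) / 2 + 10 * g.natDegree * Real.sqrt (Fintype.card F) := by
  have hD := hg.natDegree_pos
  have hSq : (Finset.univ.filter fun x : F => g.eval x ^ c = 1).card ≤ Fintype.card F :=
    Finset.card_le_univ _
  have hst := stepanov g hg h0 c hq
  generalize (Finset.univ.filter fun x : F => g.eval x ^ c = 1).card = S at *
  generalize hqq : Fintype.card F = q at *
  generalize g.natDegree = D at *
  obtain ⟨M, hMdef⟩ : ∃ M, M = Nat.sqrt q := ⟨_, rfl⟩
  have hM1 : M * M ≤ q := by rw [hMdef]; exact Nat.sqrt_le q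
  have hM2 : q < (M + 1) * (M + 1) := by rw [hMdef]; exact Nat.lt_succ_sqrt q
  have hsq : Real.sqrt q * Real.sqrt q = q := Real.mul_self_sqrt (by positivity)
  have hs0 : 0 ≤ Real.sqrt q := Real.sqrt_nonneg _
  have hsM : Real.sqrt q ≤ M + 1 := by
    rw [Real.sqrt_le_left (by positivity)]
    have : (q : ℝ) < (M + 1) * (M + 1) := by exact_mod_cast hM2
    nlinarith
  have hDr : (1 : ℝ) ≤ D := by exact_mod_cast hD
  have hSr : (S : ℝ) ≤ q := by exact_mod_cast hSq
  have hq0 : (0 : ℝ) ≤ q := by positivity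
  by_cases hcase : M < 2 * D + 7
  · have : (M : ℝ) + 1 ≤ 2 * D + 7 := by exact_mod_cast hcase
    have h9 : Real.sqrt q ≤ 9 * D := by linarith
    nlinarith
  · push Not at hcase
    have hMq : M ≤ q := le_trans (Nat.le_mul_self M) hM1
    have hDq : (D + 1) * (D + 3) < 2 * q := by nlinarith
    have hDq' : D + 2 ≤ q := by omega
    obtain ⟨K, hK⟩ : ∃ K, K = (q - D) / 2 := ⟨_, rfl⟩
    obtain ⟨J, hJ⟩ : ∃ J, J = (M + 1) / 2 + D + 3 := ⟨_, rfl⟩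
    have hJM : J ≤ M := by omega
    have hK2 : q ≤ 2 * K + D + 1 := by omega
    have hK3 : 2 * K + D ≤ q := by omega
    have hJ2 : M + 2 * D + 6 ≤ 2 * J := by omega
    have hJ3 : 2 * J ≤ M + 2 * D + 7 := by omega
    have hdim : M * (K + M * D + J) < 2 * (J * K) := by
      have e1 : K * (M + 2 * D + 6) ≤ K * (2 * J) := Nat.mul_le_mul_left _ hJ2
      have e2 : M * M * D ≤ q * D := Nat.mul_le_mul_right _ hM1
      have e3 : M * J ≤ M * M := Nat.mul_le_mul_left _ hJM
      have e4 : q * (D + 3) ≤ (2 * K + D + 1) * (D + 3) := Nat.mul_le_mul_right _ hK2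
      nlinarith
    have := hst J K M (by omega) (by omega) (by omega) hMq hdim
    have hfin : 2 * (M * S) ≤ q + q * D + q * (M + 2 * D + 5) := by
      have e1 : 2 * (c * D) ≤ q * D := by rw [hq]; nlinarith
      have e2 : q * (2 * (J - 1)) ≤ q * (M + 2 * D + 5) := Nat.mul_le_mul_left _ (by omega)
      have e3 : 2 * (K - 1) ≤ q := by omega
      nlinarith
    have hfinr : 2 * ((M : ℝ) * S) ≤ q + q * D + q * (M + 2 * D + 5) := by exact_mod_cast hfin
    have hMr : (1 : ℝ) ≤ M := by
      have : 1 ≤ M := by omega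
      exact_mod_cast this
    have hqM : (q : ℝ) ≤ 2 * M * Real.sqrt q := by nlinarith
    have : (M : ℝ) * S ≤ M * ((q : ℝ) / 2 + 10 * D * Real.sqrt q) := by
      have : (q : ℝ) * (3 * D + 6) ≤ 2 * M * Real.sqrt q * (9 * D) := by
        apply mul_le_mul hqM (by linarith) (by positivity) (by positivity)
      nlinarith [mul_nonneg (mul_nonneg (by positivity : (0:ℝ) ≤ M) hs0) (by positivity : (0:ℝ) ≤ D)]
    exact le_of_mul_le_mul_left this (by linarith)

lemma NotSq.ne_zero {F : Type*} [Field F] {g : F[X]} (hg : NotSq g) : g ≠ 0 := fun h =>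
  hg 0 0 (by simp [h])

lemma NotSq.taylor {F : Type*} [Field F] {g : F[X]} (hg : NotSq g) (b : F) : NotSq (taylor b g) := by
  intro c h e
  apply hg c (Polynomial.taylor (-b) h)
  have := congrArg (Polynomial.taylor (-b)) e
  rw [taylor_taylor, neg_add_cancel, taylor_zero, taylor_mul, taylor_pow, taylor_C] at this
  exact this

lemma NotSq.smul {F : Type*} [Field F] {g : F[X]} (hg : NotSq g) (b : F) (hb : b ≠ 0) : NotSq (C b * g) := by
  intro c h e
  apply hg (b⁻¹ * c) h
  rw [C_mul, mul_assoc, ← e, ← mul_assoc, ← C_mul, inv_mul_cancel₀ hb]; simp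

lemma stepanov_bound {F : Type*} [Field F] [Fintype F] [DecidableEq F] (g : F[X]) (hg : NotSq g)
    (c : ℕ) (hq : Fintype.card F = 2 * c + 1) :
    ((Finset.univ.filter fun x : F => g.eval x ^ c = 1).card : ℝ) ≤
      (Fintype.card F : ℝ) / 2 + 10 * g.natDegree * Real.sqrt (Fintype.card F) := by
  by_cases hx : ∃ b : F, g.eval b ≠ 0
  · obtain ⟨b, hb⟩ := hx
    have := stepanov_bound0 (taylor b g) (hg.taylor b) (by rwa [taylor_coeff_zero]) c hq
    rw [natDegree_taylor] at this
    convert this using 2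
    apply Finset.card_bij' (fun x _ => x - b) (fun x _ => x + b)
    · intro a ha; simpa [taylor_eval] using ha
    · intro a ha; simpa [taylor_eval] using ha
    · simp
    · simp
  · push Not at hx
    have hc : c ≠ 0 := by
      rintro rfl
      have := Fintype.one_lt_card (α := F)
      omega
    have : (Finset.univ.filter fun x : F => g.eval x ^ c = 1) = ∅ := by
      apply Finset.filter_false_of_mem
      intro x _
      rw [hx, zero_pow hc]; simp
    rw [this]
    simp only [Finset.card_empty, Nat.cast_zero]
    positivity

lemma weil_upper {F : Type*} [Field F] [Fintype F] [DecidableEq F] (hodd : Odd (Fintype.card F))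
    (g : F[X]) (hg : NotSq g) :
    ((∑ x : F, quadraticChar F (g.eval x) : ℤ) : ℝ) ≤ 21 * g.natDegree * Real.sqrt (Fintype.card F) := by
  obtain ⟨c, hc⟩ := hodd
  have hchar : ringChar F ≠ 2 := by
    intro h
    have := FiniteField.even_card_of_char_two h
    omega
  have hS := stepanov_bound g hg c hc
  have hc2 : Fintype.card F / 2 = c := by omega
  have e1 : ∀ x : F, quadraticChar F (g.eval x) ≤
      2 * (if g.eval x ^ c = 1 then 1 else 0) + (if g.eval x = 0 then 1 else 0) - 1 := by
    intro x
    by_cases h0 : g.eval x = 0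
    · simp only [h0, MulChar.map_zero, if_true]
      split_ifs <;> norm_num
    · have := quadraticChar_eq_pow_of_char_ne_two hchar h0
      rw [hc2] at this
      rw [this]; simp only [h0, if_false]
      split_ifs <;> norm_num
  have e2 : ∑ x : F, quadraticChar F (g.eval x) ≤
      2 * ((Finset.univ.filter fun x : F => g.eval x ^ c = 1).card : ℤ)
      + ((Finset.univ.filter fun x : F => g.eval x = 0).card : ℤ) - Fintype.card F := by
    refine (Finset.sum_le_sum fun x _ => e1 x).trans (le_of_eq ?_)
    rw [Finset.sum_sub_distrib, Finset.sum_add_distrib, ← Finset.mul_sum, Finset.sum_boole, Finset.sum_boole]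
    simp
  have e3 : (Finset.univ.filter fun x : F => g.eval x = 0).card ≤ g.natDegree := by
    refine le_trans ?_ (card_roots' g)
    refine le_trans (Finset.card_le_card ?_) (Multiset.toFinset_card_le g.roots)
    intro x hx
    simp at hx
    simp [hg.ne_zero, hx]
  have e2r : ((∑ x : F, quadraticChar F (g.eval x) : ℤ) : ℝ) ≤
      2 * ((Finset.univ.filter fun x : F => g.eval x ^ c = 1).card : ℝ)
      + ((Finset.univ.filter fun x : F => g.eval x = 0).card : ℝ) - Fintype.card F := by exact_mod_cast e2
  have e3r : ((Finset.univ.filter fun x : F => g.eval x = 0).card : ℝ) ≤ g.natDegree := by exact_mod_cast e3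
  have hs : 1 ≤ Real.sqrt (Fintype.card F) := by
    rw [Real.one_le_sqrt]
    exact_mod_cast Fintype.card_pos
  have : (g.natDegree : ℝ) ≤ g.natDegree * Real.sqrt (Fintype.card F) :=
    le_mul_of_one_le_right (by positivity) hs
  linarith

lemma weil_abs {F : Type*} [Field F] [Fintype F] [DecidableEq F] (hodd : Odd (Fintype.card F))
    (g : F[X]) (hg : NotSq g) :
    |((∑ x : F, quadraticChar F (g.eval x) : ℤ) : ℝ)| ≤ 21 * g.natDegree * Real.sqrt (Fintype.card F) := by
  have hchar : ringChar F ≠ 2 := by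
    intro h
    have := FiniteField.even_card_of_char_two h
    obtain ⟨c, hc⟩ := hodd
    omega
  obtain ⟨b, hb⟩ := quadraticChar_exists_neg_one hchar
  have hb0 : b ≠ 0 := by rintro rfl; simp at hb
  rw [abs_le]
  refine ⟨?_, weil_upper hodd g hg⟩
  have := weil_upper hodd _ (hg.smul b hb0)
  rw [natDegree_C_mul hb0] at this
  simp only [eval_mul, eval_C, map_mul, hb] at this
  simp only [neg_mul, one_mul, Finset.sum_neg_distrib, Int.cast_neg] at this
  linarith


/-- iterates -/
noncomputable def It {F : Type*} [Field F] (f : F[X]) : ℕ → F[X]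
  | 0 => X
  | n + 1 => (It f n).comp f

lemma It_eval {F : Type*} [Field F] (f : F[X]) (n : ℕ) (x : F) :
    (It f n).eval x = f.eval^[n] x := by
  induction n generalizing x with
  | zero => simp [It]
  | succ n ih => rw [It, eval_comp, ih, Function.iterate_succ_apply]

lemma It_natDegree {F : Type*} [Field F] (f : F[X]) (n : ℕ) :
    (It f n).natDegree = f.natDegree ^ n := by
  induction n with
  | zero => simp [It]
  | succ n ih => rw [It, natDegree_comp, ih, pow_succ]

lemma It_ne_zero {F : Type*} [Field F] (f : F[X]) (hf : 2 ≤ f.natDegree) (n : ℕ) : It f n ≠ 0 := by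
  intro h
  have := It_natDegree f n
  rw [h, natDegree_zero] at this
  have h2 : 0 < f.natDegree ^ n := by positivity
  omega

lemma sum_pow_le (d k : ℕ) (hd : 2 ≤ d) : ∑ i ∈ Finset.range k, d ^ i ≤ d ^ k := by
  induction k with
  | zero => simp
  | succ k ih =>
    rw [Finset.sum_range_succ, pow_succ]
    nlinarith [Nat.zero_le (d ^ k)]

lemma pattern_card {F : Type*} [Field F] [Fintype F] [DecidableEq F] (hodd : Odd (Fintype.card F))
    (f : F[X]) (hd : 2 ≤ f.natDegree)
    (H : ∀ S : Finset ℕ, S.Nonempty → NotSq (∏ i ∈ S, It f i)) (k : ℕ) (ε : ℕ → ℤ) :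
    ((Finset.univ.filter fun x : F => ∀ i < k, quadraticChar F (f.eval^[i] x) = ε i).card : ℝ) ≤
      (Fintype.card F : ℝ) / 2 ^ k + 21 * (f.natDegree : ℝ) ^ k * Real.sqrt (Fintype.card F) := by
  have hs : 1 ≤ Real.sqrt (Fintype.card F) := by
    rw [Real.one_le_sqrt]
    exact_mod_cast Fintype.card_pos
  set A := Finset.univ.filter fun x : F => ∀ i < k, quadraticChar F (f.eval^[i] x) = ε i with hA
  by_cases hne : A = ∅
  · rw [hne]; simp only [Finset.card_empty, Nat.cast_zero]; positivity
  obtain ⟨x0, hx0⟩ := Finset.nonempty_iff_ne_empty.2 hne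
  have hx0' : ∀ i < k, quadraticChar F (f.eval^[i] x0) = ε i := by simpa [hA] using hx0
  by_cases hz : ∃ i < k, ε i = 0
  · obtain ⟨i, hik, hi⟩ := hz
    have h1 : A.card ≤ f.natDegree ^ k := by
      refine le_trans ?_ (Nat.pow_le_pow_right (by omega : f.natDegree > 0) hik.le)
      rw [← It_natDegree]
      refine le_trans ?_ (card_roots' (It f i))
      refine le_trans (Finset.card_le_card ?_) (Multiset.toFinset_card_le _)
      intro x hx
      have hx' : ∀ i < k, quadraticChar F (f.eval^[i] x) = ε i := by simpa [hA] using hx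
      have := hx' i hik
      rw [hi, quadraticChar_eq_zero_iff] at this
      rw [Multiset.mem_toFinset, mem_roots (It_ne_zero f hd i), IsRoot.def, It_eval, this]
    have h1r : (A.card : ℝ) ≤ (f.natDegree : ℝ) ^ k := by exact_mod_cast h1
    have h2 : (f.natDegree : ℝ) ^ k ≤ (f.natDegree : ℝ) ^ k * Real.sqrt (Fintype.card F) :=
      le_mul_of_one_le_right (by positivity) hs
    have h3 : (0:ℝ) ≤ (Fintype.card F : ℝ) / 2 ^ k := by positivity
    have h4 : (0:ℝ) ≤ (f.natDegree : ℝ) ^ k := by positivity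
    linarith
  · push Not at hz
    have hε : ∀ i < k, ε i * ε i = 1 := by
      intro i hi
      have h0 := hz i hi
      rw [← hx0' i hi] at h0 ⊢
      have h1 : f.eval^[i] x0 ≠ 0 := by
        intro h; rw [h] at h0; simp at h0
      have := quadraticChar_sq_one h1
      rwa [sq] at this
    have hεle : ∀ i < k, |ε i| ≤ 1 := by
      intro i hi
      have := hε i hi
      rw [← abs_mul_abs_self] at this
      nlinarith [abs_nonneg (ε i)]
    have hup : (2:ℤ) ^ k * A.card ≤ ∑ x : F, ∏ i ∈ Finset.range k, (1 + ε i * quadraticChar F (f.eval^[i] x)) := by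
      calc (2:ℤ) ^ k * A.card = ∑ x ∈ A, (2:ℤ) ^ k := by simp [mul_comm]
        _ = ∑ x ∈ A, ∏ i ∈ Finset.range k, (1 + ε i * quadraticChar F (f.eval^[i] x)) := by
            apply Finset.sum_congr rfl
            intro x hx
            have hx' : ∀ i < k, quadraticChar F (f.eval^[i] x) = ε i := by simpa [hA] using hx
            rw [Finset.prod_congr rfl (g := fun _ => (2:ℤ))]
            · simp
            · intro i hi
              rw [hx' i (Finset.mem_range.1 hi), hε i (Finset.mem_range.1 hi)]; norm_num
        _ ≤ _ := by
            apply Finset.sum_le_sum_of_subset_of_nonneg (Finset.subset_univ _)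
            intro x _ _
            apply Finset.prod_nonneg
            intro i hi
            have h1 := hεle i (Finset.mem_range.1 hi)
            have h2 : |quadraticChar F (f.eval^[i] x)| ≤ 1 := by
              by_cases h : f.eval^[i] x = 0
              · simp [h]
              · rcases quadraticChar_dichotomy h with h | h <;> simp [h]
            have h3 : |ε i * quadraticChar F (f.eval^[i] x)| ≤ 1 := by
              rw [abs_mul]; exact mul_le_one₀ h1 (abs_nonneg _) h2
            have := (abs_le.1 h3).1
            linarith
    have hexp : ∑ x : F, ∏ i ∈ Finset.range k, (1 + ε i * quadraticChar F (f.eval^[i] x)) =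
        ∑ S ∈ (Finset.range k).powerset, (∏ i ∈ S, ε i) * ∑ x : F, quadraticChar F ((∏ i ∈ S, It f i).eval x) := by
      simp_rw [Finset.prod_one_add, Finset.mul_sum]
      rw [Finset.sum_comm]
      apply Finset.sum_congr rfl
      intro S _
      apply Finset.sum_congr rfl
      intro x _
      rw [eval_prod, map_prod, ← Finset.prod_mul_distrib]
      simp_rw [It_eval]
    rw [hexp, ← Finset.add_sum_erase _ _ (Finset.empty_mem_powerset _)] at hup
    have hupr : (2:ℝ) ^ k * A.card ≤ (Fintype.card F : ℝ) + ∑ S ∈ (Finset.range k).powerset.erase ∅,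
        ((∏ i ∈ S, ε i : ℤ) : ℝ) * ((∑ x : F, quadraticChar F ((∏ i ∈ S, It f i).eval x) : ℤ) : ℝ) := by
      have := hup
      simp only [Finset.prod_empty, one_mul, eval_one, map_one, Finset.sum_const, Finset.card_univ, nsmul_eq_mul, mul_one] at this
      exact_mod_cast this
    have hterm : ∀ S ∈ (Finset.range k).powerset.erase ∅,
        ((∏ i ∈ S, ε i : ℤ) : ℝ) * ((∑ x : F, quadraticChar F ((∏ i ∈ S, It f i).eval x) : ℤ) : ℝ)
        ≤ 21 * (f.natDegree : ℝ) ^ k * Real.sqrt (Fintype.card F) := by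
      intro S hS
      rw [Finset.mem_erase, Finset.mem_powerset] at hS
      obtain ⟨hS0, hSk⟩ := hS
      have hw := weil_abs hodd _ (H S (Finset.nonempty_iff_ne_empty.2 hS0))
      have hdeg : (∏ i ∈ S, It f i).natDegree ≤ f.natDegree ^ k := by
        rw [natDegree_prod _ _ (fun i _ => It_ne_zero f hd i)]
        simp_rw [It_natDegree]
        exact (Finset.sum_le_sum_of_subset hSk).trans (sum_pow_le _ _ hd)
      have hdegr : ((∏ i ∈ S, It f i).natDegree : ℝ) ≤ (f.natDegree : ℝ) ^ k := by exact_mod_cast hdeg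
      have hpr : |((∏ i ∈ S, ε i : ℤ) : ℝ)| ≤ 1 := by
        rw [← Int.cast_abs, Finset.abs_prod]
        have : ∏ i ∈ S, |ε i| ≤ 1 := Finset.prod_le_one (fun _ _ => abs_nonneg _)
          (fun i hi => hεle i (Finset.mem_range.1 (hSk hi)))
        exact_mod_cast this
      refine (le_abs_self _).trans ?_
      rw [abs_mul]
      calc _ ≤ 1 * (21 * ((∏ i ∈ S, It f i).natDegree : ℝ) * Real.sqrt (Fintype.card F)) :=
            mul_le_mul hpr hw (abs_nonneg _) (by norm_num)
        _ ≤ _ := by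
            rw [one_mul]
            gcongr
    have hsum := Finset.sum_le_card_nsmul _ _ _ hterm
    have hcard : (((Finset.range k).powerset.erase ∅).card : ℝ) ≤ 2 ^ k := by
      have : ((Finset.range k).powerset.erase ∅).card ≤ 2 ^ k := by
        refine (Finset.card_le_card (Finset.erase_subset _ _)).trans ?_
        simp
      exact_mod_cast this
    rw [nsmul_eq_mul] at hsum
    have hsum2 := hsum.trans (mul_le_mul_of_nonneg_right hcard (by positivity))
    have hfin : (2:ℝ) ^ k * A.card ≤ 2 ^ k * ((Fintype.card F : ℝ) / 2 ^ k + 21 * (f.natDegree : ℝ) ^ k * Real.sqrt (Fintype.card F)) := by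
      rw [mul_add, mul_div_cancel₀ _ (by positivity)]
      linarith
    exact le_of_mul_le_mul_left hfin (by positivity)

lemma chi_eq {F : Type*} [Field F] [Fintype F] [DecidableEq F] (x : F) : chi x = quadraticChar F x := by
  unfold chi
  rw [quadraticChar_apply, quadraticCharFun]
  split_ifs <;> rfl

lemma orbit_bound {F : Type*} [Field F] [Fintype F] (hodd : Odd (Fintype.card F))
    (f : F[X]) (hd : 2 ≤ f.natDegree)
    (H : ∀ S : Finset ℕ, S.Nonempty → NotSq (∏ i ∈ S, It f i)) (k : ℕ) (a : F) (m : ℕ) (hm : 0 < m)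
    (hper : ∀ n : ℕ, chi (f.eval^[n + m] a) = chi (f.eval^[n] a)) :
    (Set.ncard (Set.range fun n : ℕ => f.eval^[n] a) : ℝ) ≤
      m * ((Fintype.card F : ℝ) / 2 ^ k + 21 * (f.natDegree : ℝ) ^ k * Real.sqrt (Fintype.card F)) := by
  classical
  let B : ℕ → Finset F := fun r => Finset.univ.filter fun x : F => ∀ i < k,
    quadraticChar F (f.eval^[i] x) = chi (f.eval^[r + i] a)
  have hper' : ∀ n, chi (f.eval^[n] a) = chi (f.eval^[n % m] a) := by
    have : Function.Periodic (fun n => chi (f.eval^[n] a)) m := hper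
    intro n
    exact (this.map_mod_nat n).symm
  have hsub : (Set.range fun n : ℕ => f.eval^[n] a) ⊆ ((Finset.range m).biUnion B : Finset F) := by
    rintro _ ⟨n, rfl⟩
    simp only [Finset.coe_biUnion, Set.mem_iUnion, Finset.mem_coe, Finset.mem_range]
    refine ⟨n % m, Nat.mod_lt _ hm, ?_⟩
    simp only [B, Finset.mem_filter, Finset.mem_univ, true_and]
    intro i _
    rw [← chi_eq, ← Function.iterate_add_apply, hper' (i + n), hper' (n % m + i)]
    congr 2
    rw [Nat.mod_add_mod, add_comm]
  have h1 : (Set.range fun n : ℕ => f.eval^[n] a).ncard ≤ ∑ r ∈ Finset.range m, (B r).card := by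
    refine (Set.ncard_le_ncard hsub (Finset.finite_toSet _)).trans ?_
    rw [Set.ncard_coe_finset]
    exact Finset.card_biUnion_le
  have h1r : ((Set.range fun n : ℕ => f.eval^[n] a).ncard : ℝ) ≤ ∑ r ∈ Finset.range m, ((B r).card : ℝ) := by
    exact_mod_cast h1
  refine h1r.trans ?_
  have := Finset.sum_le_card_nsmul (Finset.range m) (fun r => ((B r).card : ℝ)) _
    (fun r _ => pattern_card hodd f hd H k (fun i => chi (f.eval^[r + i] a)))
  rw [Finset.card_range, nsmul_eq_mul] at this
  exact this

lemma final_opt (d q : ℕ) (hd : 2 ≤ d) (hq : 1 ≤ q) : ∃ k : ℕ,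
    (q : ℝ) / 2 ^ k + 21 * (d : ℝ) ^ k * Real.sqrt q ≤
      23 * (q : ℝ) ^ ((2 * Real.logb 2 d + 1) / (2 * Real.logb 2 d + 2)) := by
  set L := Real.logb 2 d with hL
  have hdr : (2:ℝ) ≤ d := by exact_mod_cast hd
  have hL0 : 0 < L := Real.logb_pos (by norm_num) (by linarith)
  have hqr : (1:ℝ) ≤ q := by exact_mod_cast hq
  have hq0 : (0:ℝ) < q := by linarith
  set y := Real.logb 2 q / (2 * L + 2) with hy
  have hy0 : 0 ≤ y := div_nonneg (Real.logb_nonneg (by norm_num) hqr) (by linarith)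
  have h2q : (2:ℝ) ^ Real.logb 2 q = q := Real.rpow_logb (by norm_num) (by norm_num) hq0
  have h2d : (2:ℝ) ^ L = d := Real.rpow_logb (by norm_num) (by norm_num) (by linarith)
  have hyq : (2:ℝ) ^ y = (q:ℝ) ^ (1 / (2 * L + 2)) := by
    conv_rhs => rw [← h2q]
    rw [← Real.rpow_mul (by norm_num)]; congr 1; rw [hy]; ring
  refine ⟨⌊y⌋₊, ?_⟩
  have hk1 : (⌊y⌋₊ : ℝ) ≤ y := Nat.floor_le hy0
  have hk2 : y < ⌊y⌋₊ + 1 := Nat.lt_floor_add_one y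
  have hA : (q : ℝ) / 2 ^ ⌊y⌋₊ ≤ 2 * (q : ℝ) ^ ((2 * L + 1) / (2 * L + 2)) := by
    rw [div_le_iff₀ (by positivity)]
    have h1 : (2:ℝ) ^ y ≤ 2 * 2 ^ ⌊y⌋₊ := by
      calc (2:ℝ) ^ y ≤ (2:ℝ) ^ ((⌊y⌋₊ : ℝ) + 1) := Real.rpow_le_rpow_of_exponent_le (by norm_num) hk2.le
        _ = 2 * 2 ^ ⌊y⌋₊ := by rw [Real.rpow_add (by norm_num), Real.rpow_natCast, Real.rpow_one]; ring
    have h2 : (q:ℝ) = (q : ℝ) ^ ((2 * L + 1) / (2 * L + 2)) * 2 ^ y := by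
      rw [hyq, ← Real.rpow_add hq0, ← add_div]
      rw [show (2 * L + 1 + 1) / (2 * L + 2) = 1 by rw [div_eq_one_iff_eq (by linarith)]; ring, Real.rpow_one]
    calc (q:ℝ) = (q : ℝ) ^ ((2 * L + 1) / (2 * L + 2)) * 2 ^ y := h2
      _ ≤ (q : ℝ) ^ ((2 * L + 1) / (2 * L + 2)) * (2 * 2 ^ ⌊y⌋₊) := by gcongr
      _ = _ := by ring
  have hB : (d : ℝ) ^ ⌊y⌋₊ * Real.sqrt q ≤ (q : ℝ) ^ ((2 * L + 1) / (2 * L + 2)) := by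
    have h1 : (d:ℝ) ^ ⌊y⌋₊ ≤ (q:ℝ) ^ (L / (2 * L + 2)) := by
      calc (d:ℝ) ^ ⌊y⌋₊ = (d:ℝ) ^ (⌊y⌋₊ : ℝ) := (Real.rpow_natCast _ _).symm
        _ ≤ (d:ℝ) ^ y := Real.rpow_le_rpow_of_exponent_le (by linarith) hk1
        _ = ((2:ℝ) ^ y) ^ L := by
            rw [← h2d, ← Real.rpow_mul (by norm_num), ← Real.rpow_mul (by norm_num), mul_comm]
        _ = _ := by rw [hyq, ← Real.rpow_mul hq0.le]; congr 1; ring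
    calc (d : ℝ) ^ ⌊y⌋₊ * Real.sqrt q ≤ (q:ℝ) ^ (L / (2 * L + 2)) * (q:ℝ) ^ (1/2 : ℝ) := by
          rw [← Real.sqrt_eq_rpow]; gcongr
      _ = _ := by
          rw [← Real.rpow_add hq0]; congr 1
          field_simp; ring
  linarith


lemma exists_sqfree {F : Type*} [Field F] (P : F[X]) (hP : P ≠ 0) :
    ∃ s h : F[X], Squarefree s ∧ P = s * h ^ 2 := by
  induction hn : P.natDegree using Nat.strong_induction_on generalizing P with
  | _ n ih =>
    by_cases hs : Squarefree P
    · exact ⟨P, 1, hs, by simp⟩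
    · unfold Squarefree at hs
      push Not at hs
      obtain ⟨x, ⟨Q, hQ⟩, hx⟩ := hs
      have hx0 : x ≠ 0 := by rintro rfl; simp at hQ; exact hP hQ
      have hQ0 : Q ≠ 0 := by rintro rfl; simp at hQ; exact hP hQ
      have hxd : 0 < x.natDegree := by
        rw [natDegree_pos_iff_degree_pos]; exact degree_pos_of_ne_zero_of_nonunit hx0 hx
      have hdeg : P.natDegree = x.natDegree + x.natDegree + Q.natDegree := by
        rw [hQ, natDegree_mul (mul_ne_zero hx0 hx0) hQ0, natDegree_mul hx0 hx0]
      obtain ⟨s, h, hs, he⟩ := ih Q.natDegree (by omega) Q hQ0 rfl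
      exact ⟨s, x * h, hs, by rw [hQ, he]; ring⟩

lemma rootMultiplicity_pow' {K : Type*} [Field K] (P : K[X]) (hP : P ≠ 0) (n : ℕ) (x : K) :
    (P ^ n).rootMultiplicity x = n * P.rootMultiplicity x := by
  classical
  rw [← count_roots, roots_pow, Multiset.count_nsmul, count_roots]

lemma odd_sqfree {F K : Type*} [Field F] [PerfectField F] [Field K] [IsAlgClosed K] [Algebra F K] [DecidableEq K]
    (P : F[X]) (hP : P ≠ 0) (O : Finset K)
    (hO : ∀ x, x ∈ O ↔ Odd ((P.map (algebraMap F K)).rootMultiplicity x)) :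
    ∃ s h : F[X], P = s * h ^ 2 ∧ s.natDegree = O.card ∧
      (∀ x, x ∈ O ↔ (s.map (algebraMap F K)).eval x = 0) := by
  obtain ⟨s, h, hs, he⟩ := exists_sqfree P hP
  have hs0 : s ≠ 0 := hs.ne_zero
  have hh0 : h ≠ 0 := by rintro rfl; simp at he; exact hP he
  have hsep : (s.map (algebraMap F K)).Separable := (PerfectField.separable_iff_squarefree.2 hs).map
  have hsm0 : s.map (algebraMap F K) ≠ 0 := Polynomial.map_ne_zero hs0
  have hhm0 : h.map (algebraMap F K) ≠ 0 := Polynomial.map_ne_zero hh0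
  have hmem : ∀ x, x ∈ O ↔ (s.map (algebraMap F K)).eval x = 0 := by
    intro x
    rw [hO, he, Polynomial.map_mul, Polynomial.map_pow, rootMultiplicity_mul (mul_ne_zero hsm0 (pow_ne_zero 2 hhm0)),
      rootMultiplicity_pow' _ hhm0]
    have h1 := rootMultiplicity_le_one_of_separable hsep x
    have h2 := rootMultiplicity_pos hsm0 (x := x)
    rw [IsRoot.def] at h2
    rw [← h2, Nat.odd_add]
    simp only [even_two, Even.mul_right, iff_true]
    constructor
    · intro h; exact h.pos
    · intro h
      have : rootMultiplicity x (s.map (algebraMap F K)) = 1 := by omega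
      rw [this]; exact odd_one
  refine ⟨s, h, he, ?_, hmem⟩
  have hO' : O = (s.map (algebraMap F K)).roots.toFinset := by
    ext x; rw [hmem, Multiset.mem_toFinset, mem_roots hsm0, IsRoot.def]
  rw [hO', Multiset.toFinset_card_of_nodup (nodup_roots hsep),
    ← (IsAlgClosed.splits _).natDegree_eq_card_roots, natDegree_map]

lemma rootMultiplicity_comp' {K : Type*} [Field K] (P f : K[X]) (hP : P ≠ 0) (hf : 0 < f.natDegree) (x : K) :
    (P.comp f).rootMultiplicity x =
      P.rootMultiplicity (f.eval x) * (f - C (f.eval x)).rootMultiplicity x := by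
  obtain ⟨Q, hQ, hnd⟩ := exists_eq_pow_rootMultiplicity_mul_and_not_dvd P hP (f.eval x)
  have hfC : f - C (f.eval x) ≠ 0 := by
    intro h
    have := congrArg natDegree (sub_eq_zero.1 h)
    rw [natDegree_C] at this; omega
  have hPc : P.comp f = (f - C (f.eval x)) ^ (P.rootMultiplicity (f.eval x)) * Q.comp f := by
    conv_lhs => rw [hQ]
    simp [mul_comp, pow_comp]
  have hQx : (Q.comp f).eval x ≠ 0 := by
    rw [eval_comp]
    intro h
    exact hnd (dvd_iff_isRoot.2 h)
  have hQ0 : Q.comp f ≠ 0 := by intro h; rw [h] at hQx; simp at hQx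
  rw [hPc, rootMultiplicity_mul (mul_ne_zero (pow_ne_zero _ hfC) hQ0), rootMultiplicity_pow' _ hfC,
    rootMultiplicity_eq_zero hQx, add_zero]

lemma RH {K : Type*} [Field K] [IsAlgClosed K] [DecidableEq K] (φ : K[X]) (hder : derivative φ ≠ 0)
    (hD : 2 ≤ φ.natDegree) (Y T : Finset K) (hYT : T.card ≤ Y.card)
    (hcl : ∀ y ∈ Y, ∀ x, φ.eval x = y → Odd ((φ - C y).rootMultiplicity x) → x ∈ T) : Y.card ≤ 2 := by
  have hfC : ∀ y, φ - C y ≠ 0 := by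
    intro y h
    have := congrArg natDegree (sub_eq_zero.1 h)
    rw [natDegree_C] at this; omega
  let R : K → Finset K := fun y => (φ - C y).roots.toFinset
  let e : K → ℕ := fun x => (φ - C (φ.eval x)).rootMultiplicity x
  have hR : ∀ x y, x ∈ R y ↔ φ.eval x = y := by
    intro x y
    simp only [R]
    rw [Multiset.mem_toFinset, mem_roots (hfC y), IsRoot.def, eval_sub, eval_C, sub_eq_zero]
  have hsum : ∀ y, ∑ x ∈ R y, e x = φ.natDegree := by
    intro y
    have h1 : ∑ x ∈ R y, (φ - C y).roots.count x = (φ - C y).roots.card := Multiset.toFinset_sum_count_eq _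
    rw [← (IsAlgClosed.splits _).natDegree_eq_card_roots, natDegree_sub_C] at h1
    rw [← h1]
    apply Finset.sum_congr rfl
    intro x hx
    rw [count_roots, ← (hR x y).1 hx]
  have hdisj : ((Y : Set K)).PairwiseDisjoint R := by
    intro y _ y' _ hne
    rw [Function.onFun, Finset.disjoint_left]
    intro x hx hx'
    rw [hR] at hx hx'
    exact hne (hx.symm.trans hx')
  have hder_bound : ∑ y ∈ Y, ∑ x ∈ R y, (e x - 1) ≤ φ.natDegree - 1 := by
    rw [← Finset.sum_biUnion hdisj]
    calc ∑ x ∈ Y.biUnion R, (e x - 1) ≤ ∑ x ∈ Y.biUnion R, (derivative φ).roots.count x := by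
          apply Finset.sum_le_sum
          intro x _
          rw [count_roots]
          have := rootMultiplicity_sub_one_le_derivative_rootMultiplicity_of_ne_zero (φ - C (φ.eval x)) x
            (by simpa using hder)
          simpa using this
      _ ≤ ∑ x ∈ Y.biUnion R ∪ (derivative φ).roots.toFinset, (derivative φ).roots.count x :=
          Finset.sum_le_sum_of_subset Finset.subset_union_left
      _ = (derivative φ).roots.card := by
          apply Multiset.sum_count_eq_card
          intro a ha
          exact Finset.mem_union_right _ (Multiset.mem_toFinset.2 ha)
      _ ≤ _ := (card_roots' _).trans (natDegree_derivative_le φ)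
  have hodd : ∑ y ∈ Y, ∑ x ∈ R y, (if Odd (e x) then 1 else 0) ≤ Y.card := by
    rw [← Finset.sum_biUnion hdisj, Finset.sum_boole]
    refine le_trans ?_ hYT
    simp only [Nat.cast_id]
    apply Finset.card_le_card
    intro x hx
    rw [Finset.mem_filter, Finset.mem_biUnion] at hx
    obtain ⟨⟨y, hy, hxy⟩, ho⟩ := hx
    rw [hR] at hxy
    apply hcl y hy x hxy
    rw [← hxy]; exact ho
  have hmain : ∑ y ∈ Y, φ.natDegree ≤ 2 * (∑ y ∈ Y, ∑ x ∈ R y, (e x - 1)) +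
      ∑ y ∈ Y, ∑ x ∈ R y, (if Odd (e x) then 1 else 0) := by
    rw [Finset.mul_sum, ← Finset.sum_add_distrib]
    apply Finset.sum_le_sum
    intro y _
    rw [← hsum y, Finset.mul_sum, ← Finset.sum_add_distrib]
    apply Finset.sum_le_sum
    intro x _
    split_ifs with h
    · obtain ⟨t, ht⟩ := h; omega
    · rw [Nat.not_odd_iff_even] at h
      obtain ⟨t, ht⟩ := h; omega
  rw [Finset.sum_const, smul_eq_mul] at hmain
  obtain ⟨D, hDD⟩ : ∃ D, φ.natDegree = D + 1 := ⟨φ.natDegree - 1, by omega⟩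
  rw [hDD] at hmain hder_bound hD
  have : Y.card * D ≤ 2 * D := by
    have : D + 1 - 1 = D := by omega
    rw [this] at hder_bound
    nlinarith
  exact Nat.le_of_mul_le_mul_right this (by omega)

lemma exists_sep {F : Type*} [Field F] [Finite F] (p : ℕ) [Fact p.Prime] [CharP F p] (f : F[X]) (hf : 0 < f.natDegree) :
    ∃ (φ : F[X]) (s : ℕ), f = φ ^ (p ^ s) ∧ derivative φ ≠ 0 := by
  induction hn : f.natDegree using Nat.strong_induction_on generalizing f with
  | _ n ih =>
    by_cases hd : derivative f = 0
    · have hp : p.Prime := Fact.out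
      have h1 := expand_contract p hd hp.ne_zero
      set g := contract p f
      let g' := g.map (frobeniusEquiv F p).symm.toRingHom
      have h2 : g = g'.map (frobenius F p) := by
        ext i
        simp [g']
      have h3 : f = g' ^ p := by
        rw [← map_frobenius_expand, ← h1, h2, map_expand]
      have hdeg : f.natDegree = p * g'.natDegree := by rw [h3, natDegree_pow]
      have hg' : 0 < g'.natDegree := by
        rcases Nat.eq_zero_or_pos g'.natDegree with h | h
        · rw [h] at hdeg; omega
        · exact h
      have := hp.two_le
      obtain ⟨φ, s, he, hφ⟩ := ih g'.natDegree (by nlinarith) g' hg' rfl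
      exact ⟨φ, s + 1, by rw [h3, he, ← pow_mul, pow_succ], hφ⟩
    · exact ⟨f, 0, by simp, hd⟩


lemma rec_e {F : Type*} [Field F] (h2 : (2 : F) ≠ 0) (A B : F) (hA : A ≠ 0) (hB : B ≠ 0) (g g2 : F[X]) (n : ℕ)
    (hg : g.natDegree = n) (hg2 : g2.natDegree = n) (hg0 : g ≠ 0) (hlc : g.coeff n = g2.coeff n)
    (he : C A * (X - C B) * g ^ 2 - C B = C A * X * g2 ^ 2) (i : ℕ) :
    ((i : F) + 1) * (2 * ((i : F) + 1) - 1) * B * g.coeff (i + 1) =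
      -(2 * ((n : F) - ((i : F) + 1) + 1) * ((n : F) + ((i : F) + 1))) * g.coeff i := by
  have hlc0 : g.coeff n ≠ 0 := by rw [← hg]; simpa using hg0
  have hg20 : g2 ≠ 0 := by rintro rfl; rw [hlc] at hlc0; simp at hlc0
  have hCA : C A ≠ 0 := by simpa using hA
  have hder : g * (g + 2 * (X - C B) * derivative g) = g2 * (g2 + 2 * X * derivative g2) := by
    have := congrArg derivative he
    simp only [derivative_sub, derivative_mul, derivative_C, derivative_X, derivative_pow] at this
    apply mul_left_cancel₀ hCA
    simp only [Nat.cast_ofNat, map_ofNat, Nat.add_one_sub_one, pow_one] at this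
    linear_combination this
  have hcop : IsCoprime g2 g := by
    refine ⟨-(C B⁻¹ * C A * X * g2), C B⁻¹ * (C A * (X - C B) * g), ?_⟩
    have hBB : C B⁻¹ * C B = (1 : F[X]) := by rw [← C_mul, inv_mul_cancel₀ hB, C_1]
    linear_combination C B⁻¹ * he + hBB
  have hdvd : g2 ∣ g + 2 * (X - C B) * derivative g :=
    hcop.dvd_of_dvd_mul_left ⟨_, hder⟩
  obtain ⟨r, hr⟩ := hdvd
  have hdeg : (g + 2 * (X - C B) * derivative g).natDegree ≤ n := by
    refine natDegree_add_le_of_degree_le hg.le ?_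
    by_cases hn : n = 0
    · have : derivative g = 0 := by
        rw [hn] at hg; rw [natDegree_eq_zero] at hg; obtain ⟨c, rfl⟩ := hg; simp
      rw [this]; simp
    · refine natDegree_mul_le.trans ?_
      have a1 : (2 * (X - C B)).natDegree ≤ 1 := by
        have : (2 * (X - C B)) = C 2 * (X - C B) := by simp only [map_ofNat]
        rw [this]
        exact (natDegree_C_mul_le _ _).trans (by simp)
      have a2 := natDegree_derivative_le g
      omega
  have hrC : ∃ c, r = C c := by
    by_cases hr0 : r = 0
    · exact ⟨0, by simp [hr0]⟩
    · rw [hr, natDegree_mul hg20 hr0, hg2] at hdeg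
      have : r.natDegree = 0 := by omega
      rw [natDegree_eq_zero] at this
      obtain ⟨c, hc⟩ := this
      exact ⟨c, hc.symm⟩
  obtain ⟨c, rfl⟩ := hrC
  have hc : c = 2 * n + 1 := by
    have := congrArg (fun P => coeff P n) hr
    simp only [coeff_add, coeff_mul_C] at this
    have e1 : 2 * (X - C B) * derivative g = C 2 * (X * derivative g) - C (2 * B) * derivative g := by
      simp only [C_mul, map_ofNat]; ring
    rw [e1, coeff_sub, coeff_C_mul, coeff_C_mul, coeff_derivative,
      coeff_eq_zero_of_natDegree_lt (by omega : g.natDegree < n + 1), zero_mul, mul_zero, sub_zero] at this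
    have e2 : (X * derivative g).coeff n = n * g.coeff n := by
      cases n with
      | zero => simp
      | succ k => rw [coeff_X_mul, coeff_derivative]; push_cast; ring
    rw [e2, ← hlc] at this
    apply mul_left_cancel₀ hlc0
    linear_combination -this
  have hr2 : g * C c = g2 + 2 * X * derivative g2 := by
    apply mul_left_cancel₀ hg20
    rw [← hder, hr]; ring
  have hr' := congrArg derivative hr
  simp only [derivative_add, derivative_mul, derivative_C, derivative_X, derivative_sub, derivative_ofNat] at hr'
  have hode : C (c ^ 2) * g = g + 2 * (X - C B) * derivative g +
      2 * X * (3 * derivative g + 2 * (X - C B) * derivative (derivative g)) := by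
    rw [C_pow]
    linear_combination C c * hr2 - hr - 2 * X * hr'
  have hode2 : C (c ^ 2) * g = g + C 8 * (X * derivative g) - C (2 * B) * derivative g +
      C 4 * (X * (X * derivative (derivative g))) - C (4 * B) * (X * derivative (derivative g)) := by
    rw [hode]
    simp only [C_mul, map_ofNat]
    ring
  have hco := congrArg (fun P => coeff P i) hode2
  simp only [coeff_add, coeff_sub, coeff_C_mul, coeff_derivative] at hco
  have x1 : (X * derivative g).coeff i = i * g.coeff i := by
    cases i with
    | zero => simp
    | succ k => rw [coeff_X_mul, coeff_derivative]; push_cast; ring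
  have x2 : (X * derivative (derivative g)).coeff i = i * (i + 1) * g.coeff (i + 1) := by
    cases i with
    | zero => simp
    | succ k => rw [coeff_X_mul, coeff_derivative, coeff_derivative]; push_cast; ring
  have x3 : (X * (X * derivative (derivative g))).coeff i = i * (i - 1) * g.coeff i := by
    rcases i with _ | _ | k
    · simp
    · simp
    · rw [coeff_X_mul, coeff_X_mul, coeff_derivative, coeff_derivative]; push_cast; ring
  rw [x1, x2, x3, hc] at hco
  apply mul_left_cancel₀ h2
  linear_combination hco

lemma rec_d {F : Type*} [Field F] (h2 : (2 : F) ≠ 0) (A A' B : F) (hA : A ≠ 0) (hA' : A' ≠ 0) (hB : B ≠ 0) (h k : F[X]) (n : ℕ)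
    (hh : h.natDegree = n + 1) (hk : k.natDegree = n) (hh0 : h ≠ 0) (hk0 : k ≠ 0)
    (hlc : A * h.coeff (n + 1) ^ 2 = A' * k.coeff n ^ 2)
    (he : C A' * X * (X - C B) * k ^ 2 - C B = C A * h ^ 2) (i : ℕ) :
    ((i : F) + 1) * (2 * ((i : F) + 1) - 1) * B * h.coeff (i + 1) =
      -(2 * (((n : F) + 1) + ((i : F) + 1) - 1) * (((n : F) + 1) - ((i : F) + 1) + 1)) * h.coeff i := by
  have hlch : h.coeff (n + 1) ≠ 0 := by rw [← hh]; simpa using hh0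
  have hlck : k.coeff n ≠ 0 := by rw [← hk]; simpa using hk0
  have hBB : C B⁻¹ * C B = (1 : F[X]) := by rw [← C_mul, inv_mul_cancel₀ hB, C_1]
  have hcop : IsCoprime k h := by
    refine ⟨C B⁻¹ * (C A' * X * (X - C B) * k), -(C B⁻¹ * C A * h), ?_⟩
    linear_combination C B⁻¹ * he + hBB
  have hder := congrArg derivative he
  simp only [derivative_sub, derivative_mul, derivative_C, derivative_X, derivative_pow] at hder
  simp only [Nat.cast_ofNat, map_ofNat, Nat.add_one_sub_one, pow_one] at hder
  have hdvd : k ∣ C (2 * A) * (h * derivative h) := by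
    refine ⟨C A' * ((2 * X - C B) * k + 2 * X * (X - C B) * derivative k), ?_⟩
    rw [C_mul, map_ofNat]
    linear_combination -hder
  have hdvd2 : k ∣ derivative h := by
    rw [← mul_assoc, mul_comm (C (2 * A)) h, mul_assoc] at hdvd
    have := hcop.dvd_of_dvd_mul_left hdvd
    have h2A : 2 * A ≠ 0 := mul_ne_zero h2 hA
    obtain ⟨w, hw⟩ := this
    refine ⟨C (2 * A)⁻¹ * w, ?_⟩
    have e : C (2 * A)⁻¹ * C (2 * A) = (1 : F[X]) := by rw [← C_mul, inv_mul_cancel₀ h2A, C_1]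
    linear_combination C (2 * A)⁻¹ * hw - derivative h * e
  obtain ⟨r, hr⟩ := hdvd2
  have hrC : ∃ c, r = C c := by
    by_cases hr0 : r = 0
    · exact ⟨0, by simp [hr0]⟩
    · have a2 := natDegree_derivative_le h
      rw [hr, natDegree_mul hk0 hr0, hk, hh] at a2
      have : r.natDegree = 0 := by omega
      rw [natDegree_eq_zero] at this
      obtain ⟨c, hc⟩ := this
      exact ⟨c, hc.symm⟩
  obtain ⟨c, rfl⟩ := hrC
  have hc : h.coeff (n + 1) * (n + 1) = k.coeff n * c := by
    have := congrArg (fun P => coeff P n) hr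
    simpa [coeff_derivative] using this
  have hAc : A * c ^ 2 = A' * ((n : F) + 1) ^ 2 := by
    apply mul_left_cancel₀ (pow_ne_zero 2 hlck)
    linear_combination (-A) * (k.coeff n * c + h.coeff (n + 1) * (n + 1)) * hc + ((n : F) + 1) ^ 2 * hlc
  have hode : C (2 * ((n : F) + 1) ^ 2) * h = (2 * X - C B) * derivative h + 2 * X * (X - C B) * derivative (derivative h) := by
    by_cases hd0 : derivative h = 0
    · have : ((n : F) + 1) = 0 := by
        have := congrArg (fun P => coeff P n) hd0
        simpa [coeff_derivative, hlch] using this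
      rw [this, hd0]; simp
    · have e1 : C A' * X * (X - C B) * (derivative h) ^ 2 - C (c ^ 2 * B) = C (A' * ((n : F) + 1) ^ 2) * h ^ 2 := by
        rw [hr, ← hAc]
        simp only [C_mul, C_pow]
        linear_combination C c ^ 2 * he
      have e2 := congrArg derivative e1
      simp only [derivative_sub, derivative_mul, derivative_C, derivative_X, derivative_pow] at e2
      simp only [Nat.cast_ofNat, map_ofNat, Nat.add_one_sub_one, pow_one] at e2
      have hCA' : C A' ≠ 0 := by simpa using hA'
      apply mul_left_cancel₀ (mul_ne_zero hCA' hd0)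
      simp only [C_mul, C_pow, map_ofNat] at e2 ⊢
      linear_combination -e2
  have hode2 : C (2 * ((n : F) + 1) ^ 2) * h = C 2 * (X * derivative h) - C B * derivative h +
      C 2 * (X * (X * derivative (derivative h))) - C (2 * B) * (X * derivative (derivative h)) := by
    rw [hode]
    simp only [C_mul, map_ofNat]
    ring
  have hco := congrArg (fun P => coeff P i) hode2
  simp only [coeff_add, coeff_sub, coeff_C_mul, coeff_derivative] at hco
  have x1 : (X * derivative h).coeff i = i * h.coeff i := by
    cases i with
    | zero => simp
    | succ k => rw [coeff_X_mul, coeff_derivative]; push_cast; ring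
  have x2 : (X * derivative (derivative h)).coeff i = i * (i + 1) * h.coeff (i + 1) := by
    cases i with
    | zero => simp
    | succ k => rw [coeff_X_mul, coeff_derivative, coeff_derivative]; push_cast; ring
  have x3 : (X * (X * derivative (derivative h))).coeff i = i * (i - 1) * h.coeff i := by
    rcases i with _ | _ | k
    · simp
    · simp
    · rw [coeff_X_mul, coeff_X_mul, coeff_derivative, coeff_derivative]; push_cast; ring
  rw [x1, x2, x3] at hco
  linear_combination hco


lemma odd_tree {F : Type*} [Field F] [Fintype F] (hodd : Odd (Fintype.card F))
    (f : F[X]) (hd : 2 ≤ f.natDegree)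
    (hnota : ¬ ∃ A B : F, ∃ e : ℕ, 1 ≤ e ∧ f = C A * (X - C B) ^ (ringChar F ^ e))
    (S : Finset ℕ) (hS : S.Nonempty) (c : F) (h : F[X]) (heq : ∏ i ∈ S, It f i = C c * h ^ 2) :
    ∃ T : Finset (AlgebraicClosure F), 0 ∈ T ∧ T.card ≤ 2 ∧
      ∀ y ∈ T, ∀ x, (f.map (algebraMap F (AlgebraicClosure F))).eval x = y →
        Odd ((f.map (algebraMap F (AlgebraicClosure F)) - C y).rootMultiplicity x) → x ∈ T := by
  classical
  set K := AlgebraicClosure F with hK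
  set σ := algebraMap F K with hσ
  have hIt0 : ∀ i, (It f i).map σ ≠ 0 := fun i => Polynomial.map_ne_zero (It_ne_zero f hd i)
  have hp0 : ∏ i ∈ S, It f i ≠ 0 := Finset.prod_ne_zero_iff.2 fun i _ => It_ne_zero f hd i
  have hc0 : c ≠ 0 := by rintro rfl; rw [heq] at hp0; simp at hp0
  have hh0 : h ≠ 0 := by rintro rfl; rw [heq] at hp0; simp at hp0
  set n := S.max' hS with hn
  have hnS : n ∈ S := S.max'_mem hS
  have hn1 : 1 ≤ n := by
    by_contra hlt
    have hn0 : n = 0 := by omega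
    have hS0 : S = {0} := by
      apply Finset.eq_singleton_iff_unique_mem.2
      refine ⟨hn0 ▸ hnS, fun x hx => ?_⟩
      have := S.le_max' x hx
      omega
    rw [hS0, Finset.prod_singleton] at heq
    have := congrArg natDegree heq
    rw [natDegree_C_mul hc0, natDegree_pow, It, natDegree_X] at this
    omega
  let U : ℕ → Finset K := fun j => ((It f j).map σ).roots.toFinset.filter
    fun x => Odd (((It f j).map σ).rootMultiplicity x)
  have hU : ∀ j x, x ∈ U j ↔ Odd (((It f j).map σ).rootMultiplicity x) := by
    intro j x
    simp only [U, Finset.mem_filter, Multiset.mem_toFinset]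
    constructor
    · exact fun h => h.2
    · intro h
      refine ⟨?_, h⟩
      rw [← Multiset.count_pos, count_roots]
      exact h.pos
  have hsum : ∀ x, Even (∑ i ∈ S, ((It f i).map σ).rootMultiplicity x) := by
    intro x
    have e1 : ∑ i ∈ S, ((It f i).map σ).rootMultiplicity x = ((∏ i ∈ S, It f i).map σ).rootMultiplicity x := by
      rw [Polynomial.map_prod]
      rw [← count_roots, roots_prod _ _ (Finset.prod_ne_zero_iff.2 fun i _ => hIt0 i)]
      rw [Multiset.count_bind]
      simp only [count_roots]
      rfl
    have hhm : h.map σ ≠ 0 := Polynomial.map_ne_zero hh0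
    have hcm : C (σ c) ≠ 0 := by simpa using hc0
    rw [e1, heq, Polynomial.map_mul, map_C, Polynomial.map_pow,
      rootMultiplicity_mul (mul_ne_zero hcm (pow_ne_zero 2 hhm)), rootMultiplicity_C, zero_add,
      rootMultiplicity_pow' _ hhm]
    exact even_two.mul_right _
  let T := (Finset.range n).biUnion U
  have hT : ∀ x, x ∈ T ↔ ∃ j < n, x ∈ U j := by intro x; simp [T]
  have hUn : ∀ x ∈ U n, x ∈ T := by
    intro x hx
    rw [hU] at hx
    by_contra hxT
    have hev : Even (∑ i ∈ S.erase n, ((It f i).map σ).rootMultiplicity x) := by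
      apply Finset.even_sum
      intro i hi
      rw [Finset.mem_erase] at hi
      have hle := S.le_max' i hi.2
      by_contra ho
      rw [Nat.not_even_iff_odd, ← hU] at ho
      apply hxT
      rw [hT]
      exact ⟨i, lt_of_le_of_ne hle hi.1, ho⟩
    have := hsum x
    rw [← Finset.add_sum_erase _ _ hnS] at this
    rw [Nat.even_add] at this
    exact (Nat.not_even_iff_odd.2 hx) (this.2 hev)
  have hfd : 0 < (f.map σ).natDegree := by rw [natDegree_map]; omega
  have hcl : ∀ y ∈ T, ∀ x, (f.map σ).eval x = y → Odd ((f.map σ - C y).rootMultiplicity x) → x ∈ T := by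
    intro y hy x hxy ho
    rw [hT] at hy
    obtain ⟨j, hj, hyj⟩ := hy
    have : x ∈ U (j + 1) := by
      rw [hU, It, Polynomial.map_comp, rootMultiplicity_comp' _ _ (hIt0 j) hfd, hxy]
      rw [hU] at hyj
      exact hyj.mul ho
    by_cases hjn : j + 1 < n
    · rw [hT]; exact ⟨j + 1, hjn, this⟩
    · have : j + 1 = n := by omega
      apply hUn; rwa [← this]
  refine ⟨T, ?_, ?_, hcl⟩
  · rw [hT]
    refine ⟨0, hn1, ?_⟩
    rw [hU]
    have : (It f 0).map σ = X - C 0 := by simp [It]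
    rw [this, rootMultiplicity_X_sub_C_self]
    exact odd_one
  · -- RH
    obtain ⟨p, hpc⟩ := CharP.exists F
    have hp : p.Prime := CharP.char_is_prime F p
    haveI : Fact p.Prime := ⟨hp⟩
    have hp2 : Odd p := by
      rcases hp.eq_two_or_odd' with h | h
      · exfalso
        subst h
        have h2 := FiniteField.even_card_of_char_two (F := F) (ringChar.eq F 2)
        obtain ⟨k, hk⟩ := hodd
        omega
      · exact h
    obtain ⟨φ, s, hφ, hφd⟩ := exists_sep p f (by omega)
    haveI : CharP K p := charP_of_injective_algebraMap (algebraMap F K).injective p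
    haveI : ExpChar K p := ExpChar.prime hp
    have hps : 0 < p ^ s := pow_pos hp.pos _
    have hdegf : f.natDegree = p ^ s * φ.natDegree := by rw [hφ, natDegree_pow]
    have hφ2 : 2 ≤ φ.natDegree := by
      by_contra hlt
      have hφ1 : φ.natDegree = 1 := by
        rcases Nat.eq_zero_or_pos φ.natDegree with h | h
        · rw [h] at hdegf; omega
        · omega
      apply hnota
      have hrc : ringChar F = p := ringChar.eq F p
      obtain ⟨a, ha, b, hab⟩ : ∃ a : F, a ≠ 0 ∧ ∃ b : F, φ = C a * X + C b := by
        obtain ⟨a, ha, b, hab⟩ := natDegree_eq_one.1 hφ1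
        exact ⟨a, ha, b, hab.symm⟩
      refine ⟨a ^ (p ^ s), -(a⁻¹ * b), s, ?_, ?_⟩
      · by_contra hs
        have : s = 0 := by omega
        rw [this, hφ1] at hdegf
        simp at hdegf; omega
      · rw [hrc, hφ, C_pow, ← mul_pow]
        congr 1
        rw [hab]
        have : C a * C (a⁻¹ * b) = C b := by rw [← C_mul, mul_inv_cancel_left₀ ha]
        rw [C_neg, sub_neg_eq_add, mul_add, this]
    have hφdm : derivative (φ.map σ) ≠ 0 := by
      rw [derivative_map]; exact Polynomial.map_ne_zero hφd
    have hfφ : f.map σ = (φ.map σ) ^ (p ^ s) := by rw [hφ, Polynomial.map_pow]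
    let Fr : K ≃+* K := iterateFrobeniusEquiv K p s
    have hFr : ∀ y, Fr y = y ^ (p ^ s) := fun y => iterateFrobeniusEquiv_def K p s y
    let Y := T.image Fr.symm
    have hYc : Y.card = T.card := Finset.card_image_of_injective _ Fr.symm.injective
    rw [← hYc]
    apply RH (φ.map σ) hφdm (by rwa [natDegree_map]) Y T hYc.ge
    intro y hy x hxy ho
    rw [Finset.mem_image] at hy
    obtain ⟨z, hz, hzy⟩ := hy
    have hzy' : z = y ^ (p ^ s) := by rw [← hzy, ← hFr, RingEquiv.apply_symm_apply]
    apply hcl z hz x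
    · rw [hfφ, eval_pow, hxy, hzy']
    · have hne : φ.map σ - C y ≠ 0 := by
        intro h
        have := congrArg natDegree (sub_eq_zero.1 h)
        rw [natDegree_C, natDegree_map] at this; omega
      have : f.map σ - C z = (φ.map σ - C y) ^ (p ^ s) := by
        rw [sub_pow_char_pow, hfφ, hzy', C_pow]
      rw [this, rootMultiplicity_pow' _ hne]
      exact (hp2.pow).mul ho


lemma odd_sq' {F : Type*} [Field F] [Fintype F] (P : F[X]) (hP : P ≠ 0) :
    ∃ (O : Finset (AlgebraicClosure F)) (s h : F[X]), P = s * h ^ 2 ∧ s.natDegree = O.card ∧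
      (∀ x, x ∈ O ↔ (s.map (algebraMap F (AlgebraicClosure F))).eval x = 0) ∧
      ∀ x, x ∈ O ↔ Odd ((P.map (algebraMap F (AlgebraicClosure F))).rootMultiplicity x) := by
  classical
  let O : Finset (AlgebraicClosure F) :=
    (P.map (algebraMap F (AlgebraicClosure F))).roots.toFinset.filter
      fun x => Odd ((P.map (algebraMap F (AlgebraicClosure F))).rootMultiplicity x)
  have hO : ∀ x, x ∈ O ↔ Odd ((P.map (algebraMap F (AlgebraicClosure F))).rootMultiplicity x) := by
    intro x
    simp only [O, Finset.mem_filter, Multiset.mem_toFinset]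
    constructor
    · exact fun h => h.2
    · intro h
      refine ⟨?_, h⟩
      rw [← Multiset.count_pos, count_roots]
      exact h.pos
  obtain ⟨s, h, h1, h2, h3⟩ := odd_sqfree P hP O hO
  exact ⟨O, s, h, h1, h2, h3, hO⟩

lemma deg_one_form {F : Type*} [Field F] (s : F[X]) (hs : s.natDegree = 1) :
    ∃ A B : F, A ≠ 0 ∧ s = C A * (X - C B) := by
  have hA : s.coeff 1 ≠ 0 := by
    have : s.leadingCoeff ≠ 0 := by
      rw [leadingCoeff_ne_zero]; rintro rfl; simp at hs
    rwa [leadingCoeff, hs] at this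
  refine ⟨s.coeff 1, -(s.coeff 0 / s.coeff 1), hA, ?_⟩
  conv_lhs => rw [eq_X_add_C_of_natDegree_le_one hs.le]
  rw [mul_sub, ← C_mul]
  have : s.coeff 1 * -(s.coeff 0 / s.coeff 1) = - s.coeff 0 := by field_simp
  rw [this, C_neg, sub_neg_eq_add]

lemma notSq_of_not_exceptional {F : Type*} [Field F] [Fintype F] (hodd : Odd (Fintype.card F))
    (f : F[X]) (hd : 2 ≤ f.natDegree) (hex : ¬ ExceptionalForm f)
    (S : Finset ℕ) (hS : S.Nonempty) : NotSq (∏ i ∈ S, It f i) := by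
  classical
  intro c h₀ heq
  apply hex
  by_cases hnota : ∃ A B : F, ∃ e : ℕ, 1 ≤ e ∧ f = C A * (X - C B) ^ (ringChar F ^ e)
  · exact Or.inl hnota
  obtain ⟨T, h0T, hTc, hT⟩ := odd_tree hodd f hd hnota S hS c h₀ heq
  have h2 : (2 : F) ≠ 0 := by
    apply Ring.two_ne_zero
    intro hc
    have := FiniteField.even_card_of_char_two (F := F) hc
    have := hodd
    rw [Nat.odd_iff] at this
    omega
  have hf0 : f ≠ 0 := by rintro rfl; simp at hd
  set σ := algebraMap F (AlgebraicClosure F) with hσ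
  have hσi : Function.Injective σ := σ.injective
  obtain ⟨O, s, h, hf, hsd, hOs, hOo⟩ := odd_sq' f hf0
  have hs0 : s ≠ 0 := by rintro rfl; simp at hf; exact hf0 hf
  have hh0 : h ≠ 0 := by rintro rfl; simp at hf; exact hf0 hf
  have hOT : ∀ x ∈ O, x ∈ T ∧ (f.map σ).eval x = 0 := by
    intro x hx
    have h1 := (hOo x).1 hx
    have h3 : (f.map σ).eval x = 0 := by
      have := (hOs x).1 hx
      rw [hf, Polynomial.map_mul, eval_mul, this, zero_mul]
    refine ⟨hT 0 h0T x h3 ?_, h3⟩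
    simpa using h1
  have hdeg : f.natDegree = O.card + 2 * h.natDegree := by
    rw [← hsd]
    conv_lhs => rw [hf]
    rw [natDegree_mul hs0 (pow_ne_zero 2 hh0), natDegree_pow]
  by_cases ht : ∃ t ∈ O, t ≠ 0
  · obtain ⟨t, htO, ht0⟩ := ht
    have hTt : ∀ x ∈ T, x = 0 ∨ x = t := by
      have : ({0, t} : Finset (AlgebraicClosure F)) = T := by
        apply Finset.eq_of_subset_of_card_le
        · intro x hx
          simp only [Finset.mem_insert, Finset.mem_singleton] at hx
          rcases hx with rfl | rfl
          · exact h0T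
          · exact (hOT _ htO).1
        · rwa [Finset.card_pair (Ne.symm ht0)]
      intro x hx
      rw [← this] at hx
      simpa using hx
    -- analysis of f - B
    have key : ∀ B : F, σ B = t → ∃ (O' : Finset (AlgebraicClosure F)) (s' h' : F[X]),
        f - C B = s' * h' ^ 2 ∧ s'.natDegree = O'.card ∧ s' ≠ 0 ∧ h' ≠ 0 ∧
        (∀ x ∈ O', x = 0 ∧ x ∉ O) ∧ (∀ x, x ∈ O' ↔ (s'.map σ).eval x = 0) ∧
        f.natDegree = O'.card + 2 * h'.natDegree := by
      intro B hB
      have hfB : (f - C B).natDegree = f.natDegree := natDegree_sub_C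
      have hfB0 : f - C B ≠ 0 := by intro h; rw [h] at hfB; simp at hfB; omega
      obtain ⟨O', s', h', hf', hsd', hOs', hOo'⟩ := odd_sq' (f - C B) hfB0
      have hs0' : s' ≠ 0 := by rintro rfl; simp only [zero_mul] at hf'; exact hfB0 hf'
      have hh0' : h' ≠ 0 := by rintro rfl; simp at hf'; exact hfB0 (by rw [hf'])
      refine ⟨O', s', h', hf', hsd', hs0', hh0', ?_, hOs', ?_⟩
      · intro x hx
        have h1 := (hOo' x).1 hx
        have h3 : (f.map σ).eval x = t := by
          have := (hOs' x).1 hx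
          have h4 : ((f - C B).map σ).eval x = 0 := by
            rw [hf', Polynomial.map_mul, eval_mul, this, zero_mul]
          rw [Polynomial.map_sub, map_C, eval_sub, eval_C, hB] at h4
          exact sub_eq_zero.1 h4
        have hxO : x ∉ O := by
          intro hxO
          have := (hOT x hxO).2
          rw [h3] at this
          exact ht0 this
        refine ⟨?_, hxO⟩
        have hxT : x ∈ T := by
          apply hT t (hOT t htO).1 x h3
          rw [Polynomial.map_sub, map_C] at h1
          rw [← hB]; exact h1
        rcases hTt x hxT with h | h
        · exact h
        · exact absurd (h ▸ htO) hxO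
      · rw [← hsd', ← hfB]
        conv_lhs => rw [hf']
        rw [natDegree_mul hs0' (pow_ne_zero 2 hh0'), natDegree_pow]
    by_cases h0O : (0 : AlgebraicClosure F) ∈ O
    · -- form (d)
      have hOe : O = {0, t} := by
        apply Finset.Subset.antisymm
        · intro x hx
          simpa using hTt x (hOT x hx).1
        · intro x hx
          simp only [Finset.mem_insert, Finset.mem_singleton] at hx
          rcases hx with rfl | rfl
          · exact h0O
          · exact htO
      have hOc : O.card = 2 := by rw [hOe, Finset.card_pair (Ne.symm ht0)]
      have hs00 : s.coeff 0 = 0 := by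
        have := (hOs 0).1 h0O
        rw [← coeff_zero_eq_eval_zero, coeff_map] at this
        exact (map_eq_zero σ).1 this
      obtain ⟨s1, hs1⟩ := X_dvd_iff.2 hs00
      have hs10 : s1 ≠ 0 := by rintro rfl; simp at hs1; exact hs0 hs1
      have hs1d : s1.natDegree = 1 := by
        have : s.natDegree = 1 + s1.natDegree := by
          rw [hs1, natDegree_mul X_ne_zero hs10, natDegree_X]
        omega
      obtain ⟨A', B, hA', hs1e⟩ := deg_one_form s1 hs1d
      have hBt : σ B = t := by
        have := (hOs t).1 htO
        rw [hs1, hs1e] at this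
        simp [ht0, hA', sub_eq_zero] at this
        exact this.symm
      have hB0 : B ≠ 0 := by rintro rfl; exact ht0 (by rw [← hBt, map_zero])
      obtain ⟨O', s', h', hf', hsd', hs0', hh0', hO', hOs', hdeg'⟩ := key B hBt
      have hO'e : O' = ∅ := by
        apply Finset.eq_empty_of_forall_notMem
        intro x hx
        obtain ⟨rfl, hn⟩ := hO' x hx
        exact hn h0O
      rw [hO'e, Finset.card_empty] at hsd'
      rw [hO'e, Finset.card_empty] at hdeg'
      obtain ⟨A, rfl⟩ : ∃ A, s' = C A := ⟨_, eq_C_of_natDegree_eq_zero hsd'⟩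
      have hA : A ≠ 0 := by rintro rfl; simp at hs0'
      have hh'd : h'.natDegree = h.natDegree + 1 := by omega
      have he : C A' * X * (X - C B) * h ^ 2 - C B = C A * h' ^ 2 := by
        rw [← hf', hf, hs1, hs1e]; ring
      have hlc : A * h'.coeff (h.natDegree + 1) ^ 2 = A' * h.coeff h.natDegree ^ 2 := by
        have e1 : (f - C B).leadingCoeff = f.leadingCoeff := by
          rw [leadingCoeff, natDegree_sub_C, coeff_sub, coeff_C, if_neg (by omega), sub_zero,
            leadingCoeff]
        rw [hf', leadingCoeff_mul, leadingCoeff_C, leadingCoeff_pow] at e1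
        rw [hf, hs1, hs1e, leadingCoeff_mul, leadingCoeff_mul, leadingCoeff_X, leadingCoeff_mul,
          leadingCoeff_C, leadingCoeff_X_sub_C, leadingCoeff_pow, one_mul, mul_one] at e1
        rw [← hh'd]
        exact e1
      have hrec := rec_d h2 A A' B hA hA' hB0 h' h h.natDegree hh'd rfl hh0' hh0 hlc he
      have hn : f.natDegree / 2 = h.natDegree + 1 := by omega
      refine Or.inr (Or.inr (Or.inr (Or.inl ⟨A, B, hA, h', ?_, ?_, ?_, ?_⟩)))
      · rw [hn, hh'd]
      · rw [← hf']; ring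
      · have := congrArg (eval 0) he
        simp only [eval_sub, eval_mul, eval_C, eval_X, eval_pow, mul_zero, zero_mul, zero_sub] at this
        rw [coeff_zero_eq_eval_zero, ← this]; ring
      · intro i hi _
        obtain ⟨j, rfl⟩ : ∃ j, i = j + 1 := ⟨i - 1, by omega⟩
        rw [hn, Nat.add_sub_cancel]
        have := hrec j
        push_cast
        exact this
    · -- form (e)
      have hOe : O = {t} := by
        apply Finset.eq_singleton_iff_unique_mem.2
        refine ⟨htO, fun x hx => ?_⟩
        rcases hTt x (hOT x hx).1 with h | h
        · exact absurd (h ▸ hx) h0O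
        · exact h
      have hOc : O.card = 1 := by rw [hOe, Finset.card_singleton]
      obtain ⟨A, B, hA, hse⟩ := deg_one_form s (by rw [hsd, hOc])
      have hBt : σ B = t := by
        have := (hOs t).1 htO
        rw [hse] at this
        simp [hA, sub_eq_zero] at this
        exact this.symm
      have hB0 : B ≠ 0 := by rintro rfl; exact ht0 (by rw [← hBt, map_zero])
      obtain ⟨O', s', h', hf', hsd', hs0', hh0', hO', hOs', hdeg'⟩ := key B hBt
      have hO'c : O'.card ≤ 1 := Finset.card_le_one.2 fun x hx y hy => by
        rw [(hO' x hx).1, (hO' y hy).1]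
      have hO'1 : O'.card = 1 := by omega
      have h0O' : (0 : AlgebraicClosure F) ∈ O' := by
        obtain ⟨x, hx⟩ := Finset.card_pos.1 (by omega : 0 < O'.card)
        rw [← (hO' x hx).1]; exact hx
      obtain ⟨A', B', hA', hse'⟩ := deg_one_form s' (by rw [hsd', hO'1])
      have hB'0 : B' = 0 := by
        have := (hOs' 0).1 h0O'
        rw [hse'] at this
        simpa [hA'] using this
      rw [hB'0, C_0, sub_zero] at hse'
      have hh'd : h'.natDegree = h.natDegree := by omega
      have hlc : A' * h'.leadingCoeff ^ 2 = A * h.leadingCoeff ^ 2 := by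
        have e1 : (f - C B).leadingCoeff = f.leadingCoeff := by
          rw [leadingCoeff, natDegree_sub_C, coeff_sub, coeff_C, if_neg (by omega), sub_zero,
            leadingCoeff]
        rw [hf', leadingCoeff_mul, hse', leadingCoeff_mul, leadingCoeff_C, leadingCoeff_pow,
          leadingCoeff_X, mul_one] at e1
        rw [hf, hse, leadingCoeff_mul, leadingCoeff_mul,
          leadingCoeff_C, leadingCoeff_X_sub_C, leadingCoeff_pow, mul_one] at e1
        exact e1
      have hl' : h'.leadingCoeff ≠ 0 := leadingCoeff_ne_zero.2 hh0'
      have hl : h.leadingCoeff ≠ 0 := leadingCoeff_ne_zero.2 hh0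
      set r := h.leadingCoeff / h'.leadingCoeff with hr
      have hr0 : r ≠ 0 := div_ne_zero hl hl'
      have hAr : A' = A * r ^ 2 := by
        rw [hr]; field_simp; exact hlc
      have he : C A * (X - C B) * h ^ 2 - C B = C A * X * (C r * h') ^ 2 := by
        have e1 : C A * (X - C B) * h ^ 2 = f := by rw [hf, hse]
        rw [e1, hf', hse', hAr, C_mul, C_pow]; ring
      have hgd : (C r * h').natDegree = h.natDegree := by rw [natDegree_C_mul hr0, hh'd]
      have hlc2 : h.coeff h.natDegree = (C r * h').coeff h.natDegree := by
        rw [coeff_C_mul, ← hh'd]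
        change _ = r * h'.leadingCoeff
        rw [hr, hh'd]
        change h.leadingCoeff = _
        field_simp
      have hrec := rec_e h2 A B hA hB0 h (C r * h') h.natDegree rfl hgd hh0 hlc2 he
      have hn : (f.natDegree - 1) / 2 = h.natDegree := by omega
      refine Or.inr (Or.inr (Or.inr (Or.inr ⟨A, B, hA, h, ?_, ?_, ?_, ?_⟩)))
      · rw [hn]
      · rw [hf, hse]
      · have := congrArg (eval 0) he
        simp only [eval_sub, eval_mul, eval_C, eval_X, eval_pow, mul_zero, zero_mul, zero_sub] at this
        rw [coeff_zero_eq_eval_zero]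
        apply mul_right_cancel₀ hB0
        linear_combination -this
      · intro i hi _
        obtain ⟨j, rfl⟩ : ∃ j, i = j + 1 := ⟨i - 1, by omega⟩
        rw [hn, Nat.add_sub_cancel]
        have := hrec j
        push_cast
        exact this
  · push Not at ht
    by_cases h0O : (0 : AlgebraicClosure F) ∈ O
    · have hOe : O = {0} := Finset.eq_singleton_iff_unique_mem.2 ⟨h0O, ht⟩
      obtain ⟨A, B, hA, hse⟩ := deg_one_form s (by rw [hsd, hOe, Finset.card_singleton])
      have hB0 : B = 0 := by
        have := (hOs 0).1 h0O
        rw [hse] at this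
        simpa [hA] using this
      rw [hB0, C_0, sub_zero] at hse
      exact Or.inr (Or.inr (Or.inl ⟨A, h, by rw [hf, hse]⟩))
    · have hOe : O = ∅ := by
        apply Finset.eq_empty_of_forall_notMem
        intro x hx
        exact h0O (ht x hx ▸ hx)
      rw [hOe, Finset.card_empty] at hsd
      exact Or.inr (Or.inl ⟨s.coeff 0, h, by rw [hf, ← eq_C_of_natDegree_eq_zero hsd]⟩)


theorem square_patterns_stmt0 (d : ℕ) (hd : 2 ≤ d) :
    ∃ Cst : ℝ, 0 < Cst ∧
      ∀ (F : Type) [Field F] [Fintype F], Odd (Fintype.card F) →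
        ∀ f : F[X], f.natDegree = d → ¬ ExceptionalForm f →
          ∀ a : F, ∀ m : ℕ,
            (0 < m ∧ (∀ n : ℕ, chi (f.eval^[n + m] a) = chi (f.eval^[n] a)) ∧
              (∀ m' : ℕ, 0 < m' →
                (∀ n : ℕ, chi (f.eval^[n + m'] a) = chi (f.eval^[n] a)) → m ≤ m')) →
            (Set.ncard (Set.range fun n : ℕ => f.eval^[n] a) : ℝ) ≤
              Cst * m * (Fintype.card F : ℝ) ^
                ((2 * Real.logb 2 d + 1) / (2 * Real.logb 2 d + 2)) := by
  refine ⟨23, by norm_num, ?_⟩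
  intro F _ _ hodd f hfd hex a m hm
  subst hfd
  obtain ⟨hm0, hper, -⟩ := hm
  obtain ⟨k, hk⟩ := final_opt f.natDegree (Fintype.card F) hd Fintype.card_pos
  have hob := orbit_bound hodd f hd (notSq_of_not_exceptional hodd f hd hex) k a m hm0 hper
  refine hob.trans ?_
  refine (mul_le_mul_of_nonneg_left hk (Nat.cast_nonneg m)).trans (le_of_eq ?_)
  ring
end

section
/- Let K be a field and let f ∈ K[x] have degree d ≥ 2. Let α₁ and α₂ be distinct roots of f in an algebraic closure K̄ of K. If the preimage tree T_{α₁}(f) is repeating, then T_{α₂}(f) is not repeating; moreover, 0 is a periodic point of f (i.e., f^t(0) = 0 for some t ≥ 1), 0 lies in T_{α₁}(f), and 0 does not lie in T_{α₂}(f). -/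
open Polynomial

/-- `β` lies in the preimage tree `T_α(f)`, i.e. `f^n(β) = α` for some `n ≥ 0`. -/
def InTree {K : Type*} [CommRing K] (f : K[X]) (α β : K) : Prop :=
  ∃ n : ℕ, (polyIter f n).eval β = α

/-- The preimage tree `T_α(f)` is repeating: some `β` lies in `R_{n,α}(f) ∩ R_{m,α}(f)`
for distinct `n, m`. -/
def TreeRepeating {K : Type*} [CommRing K] (f : K[X]) (α : K) : Prop :=
  ∃ n m : ℕ, n ≠ m ∧ ∃ β : K, (polyIter f n).eval β = α ∧ (polyIter f m).eval β = α

theorem polyIter_eval_aux {L : Type*} [CommRing L] (F : L[X]) (n : ℕ) (x : L) :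
    (polyIter F n).eval x = (fun y => F.eval y)^[n] x := by
  induction n with
  | zero => simp [polyIter]
  | succ n ih => rw [polyIter, eval_comp, ih, Function.iterate_succ_apply']

theorem inTree_zero_aux {L : Type*} [CommRing L] (F : L[X]) (α : L) (h : F.eval α = 0)
    (hr : TreeRepeating F α) : InTree F α 0 := by
  obtain ⟨n, m, hnm, β, hn, hm⟩ := hr
  wlog hlt : n < m generalizing n m
  · exact this m n hnm.symm hm hn (by omega)
  obtain ⟨k, rfl⟩ := Nat.exists_eq_add_of_lt hlt
  refine ⟨k, ?_⟩
  rw [polyIter_eval_aux] at hn hm ⊢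
  rw [show n + k + 1 = (k + 1) + n by omega, Function.iterate_add_apply, hn,
    Function.iterate_succ_apply] at hm
  simpa only [h] using hm

theorem square_patterns_stmt3 {K : Type*} [Field K] (f : K[X]) (hd : 2 ≤ f.natDegree)
    (α₁ α₂ : AlgebraicClosure K) (hne : α₁ ≠ α₂)
    (h₁ : Polynomial.aeval α₁ f = 0) (h₂ : Polynomial.aeval α₂ f = 0)
    (hrep : TreeRepeating (f.map (algebraMap K (AlgebraicClosure K))) α₁) :
    ¬ TreeRepeating (f.map (algebraMap K (AlgebraicClosure K))) α₂ ∧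
    (∃ t : ℕ, 1 ≤ t ∧ (polyIter (f.map (algebraMap K (AlgebraicClosure K))) t).eval 0 = 0) ∧
    InTree (f.map (algebraMap K (AlgebraicClosure K))) α₁ 0 ∧
    ¬ InTree (f.map (algebraMap K (AlgebraicClosure K))) α₂ 0 := by
  set F := f.map (algebraMap K (AlgebraicClosure K)) with hF
  have e₁ : F.eval α₁ = 0 := by rw [hF, eval_map_algebraMap, h₁]
  have e₂ : F.eval α₂ = 0 := by rw [hF, eval_map_algebraMap, h₂]
  obtain ⟨k, hk⟩ := inTree_zero_aux F α₁ e₁ hrep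
  have hper : (fun x => F.eval x)^[k+1] 0 = 0 := by
    rw [Function.iterate_succ_apply', ← polyIter_eval_aux, hk]; exact e₁
  have hnot : ¬ InTree F α₂ 0 := by
    rintro ⟨n, hn⟩
    rw [polyIter_eval_aux] at hn hk
    apply hne
    have h : (fun x => F.eval x)^[k+1] α₂ = α₂ := by
      rw [← hn, ← Function.iterate_add_apply, add_comm, Function.iterate_add_apply, hper]
    rw [Function.iterate_succ_apply] at h
    simp only [e₂] at h
    exact hk.symm.trans h
  exact ⟨fun h => hnot (inTree_zero_aux F α₂ e₂ h),
    ⟨k + 1, by omega, by rw [polyIter_eval_aux]; exact hper⟩, ⟨k, hk⟩, hnot⟩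
end

section
/- Let K be a field and let f ∈ K[x] have degree d ≥ 2. Suppose that f is not of the form A(x−B)^d for any A, B in an algebraic closure of K (equivalently, f has at least two distinct roots in the algebraic closure). Then f is dynamically ordinary. -/
open Polynomial

/-- `f` is dynamically ordinary: for every `n ≥ 1` there is an irreducible factor of `f^n`
that does not divide `f^i` for any `i < n`. -/
def DynOrdinary {K : Type*} [Field K] (f : K[X]) : Prop :=
  ∀ n : ℕ, 1 ≤ n → ∃ g : K[X], Irreducible g ∧ g ∣ polyIter f n ∧
    ∀ i : ℕ, i < n → ¬ g ∣ polyIter f i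

lemma aeval_polyIter' {K L : Type*} [Field K] [Field L] [Algebra K L] (f : K[X]) (x : L) (n : ℕ) :
    aeval x (polyIter f n) = (fun y : L => aeval y f)^[n] x := by
  induction n with
  | zero => simp [polyIter]
  | succ n ih => rw [polyIter, aeval_comp, ih, Function.iterate_succ_apply']

lemma orbit_aux {α : Type*} (F : α → α) (o : α) (j k : ℕ) (hj : F (F^[j] o) = o)
    (hk : F (F^[k] o) = o) : F^[j] o = F^[k] o := by
  rw [← Function.iterate_succ_apply' F] at hj hk
  have hj2 : ∀ m, F^[(j+1)*m] o = o := fun m => by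
    rw [Function.iterate_mul]; exact Function.iterate_fixed hj m
  have hk2 : ∀ m, F^[(k+1)*m] o = o := fun m => by
    rw [Function.iterate_mul]; exact Function.iterate_fixed hk m
  have h1 : F^[j + (j+1)*k] o = F^[j] o := by rw [Function.iterate_add_apply, hj2]
  have h2 : F^[k + (k+1)*j] o = F^[k] o := by rw [Function.iterate_add_apply, hk2]
  rw [← h1, ← h2]
  congr 1
  ring

theorem square_patterns_stmt4 {K : Type*} [Field K] (f : K[X]) (hd : 2 ≤ f.natDegree)
    (hform : ¬ ∃ A B : AlgebraicClosure K,
      f.map (algebraMap K (AlgebraicClosure K)) = C A * (X - C B) ^ f.natDegree) :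
    DynOrdinary f := by
  intro n hn
  obtain ⟨n, rfl⟩ : ∃ m, n = m + 1 := ⟨n - 1, by omega⟩
  set L := AlgebraicClosure K
  set F : L → L := fun y => aeval y f with hF
  have hsurj : Function.Surjective F := by
    intro b
    have hdeg : (f.map (algebraMap K L) - C b).degree ≠ 0 := by
      rw [degree_sub_C] <;> rw [degree_map]
      · intro h
        have : f.natDegree = 0 := natDegree_eq_of_degree_eq_some h
        omega
      · exact natDegree_pos_iff_degree_pos.mp (by omega)
    obtain ⟨x, hx⟩ := IsAlgClosed.exists_root _ hdeg
    refine ⟨x, ?_⟩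
    simpa [IsRoot, sub_eq_zero, eval_map_algebraMap] using hx
  obtain ⟨β, hβ, hβo⟩ : ∃ β : L, F β = 0 ∧ ∀ j, F^[j] 0 ≠ β := by
    by_contra! hcon
    apply hform
    obtain ⟨B, hB⟩ := hsurj 0
    refine ⟨(f.map (algebraMap K L)).leadingCoeff, B, ?_⟩
    have hs : (f.map (algebraMap K L)).Splits := IsAlgClosed.splits _
    have hr : (f.map (algebraMap K L)).roots = Multiset.replicate f.natDegree B := by
      rw [Multiset.eq_replicate]
      constructor
      · rw [← hs.natDegree_eq_card_roots, natDegree_map]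
      · intro b hb
        have hb0 : F b = 0 := by
          simpa [IsRoot, eval_map_algebraMap] using isRoot_of_mem_roots hb
        obtain ⟨j, rfl⟩ := hcon b hb0
        obtain ⟨k, rfl⟩ := hcon B hB
        exact orbit_aux F 0 j k hb0 hB
    have := hs.eq_prod_roots
    rw [hr] at this
    simpa using this
  obtain ⟨α, hα⟩ := hsurj.iterate n β
  refine ⟨minpoly K α, minpoly.irreducible (Algebra.IsIntegral.isIntegral α), ?_, ?_⟩
  · apply minpoly.dvd
    rw [aeval_polyIter', Function.iterate_succ_apply']
    change F (F^[n] α) = 0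
    rw [hα, hβ]
  · intro i hi hdvd
    have h0 : F^[i] α = 0 := by
      rw [← aeval_polyIter']
      exact (minpoly.dvd_iff).mp hdvd
    apply hβo (n - i)
    rw [← h0, ← Function.iterate_add_apply, Nat.sub_add_cancel (by omega), hα]
end

section
/- Let K be a field such that either char(K) = 0, or char(K) is an odd prime p with p ≥ d. Let d ≥ 3 be odd, n = (d−1)/2, and suppose f ∈ K[x] has the form f = A(x−B)·g², where A, B ∈ K, A ≠ 0, and g = Σ_{i=0}^{n} a_i x^i ∈ K[x] of degree n satisfies A·a_0² = −1 and i(2i−1)B·a_i = −2(n−i+1)(n+i)·a_{i−1} for all i ∈ {1,…,n}. Then f is K-conjugate to −T_d(x), the negative of the degree-d Chebyshev polynomial. -/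
open Polynomial

noncomputable def VV (K : Type*) [Field K] (n : ℕ) : K[X] :=
  Chebyshev.U K n - Chebyshev.U K ((n : ℤ) - 1)

theorem VV_T {K : Type*} [Field K] (n : ℕ) :
    VV K n ^ 2 + VV K (n+1) ^ 2 - 2 * X * VV K n * VV K (n+1) = 2 * (1 - X) ∧
    Chebyshev.T K (2 * (n : ℤ) + 1) = (X + 1) * VV K n ^ 2 - 1 ∧
    Chebyshev.T K (2 * (n : ℤ) + 2) = (X + 1) * VV K n * VV K (n+1) - X := by
  induction n with
  | zero =>
    simp [VV, Chebyshev.T_two]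
    refine ⟨?_, ?_⟩ <;> ring
  | succ n ih =>
    obtain ⟨h1, h2, h3⟩ := ih
    have hV : VV K (n+1+1) = 2 * X * VV K (n+1) - VV K n := by
      have e1 := Chebyshev.U_add_two K (n : ℤ)
      have e2 := Chebyshev.U_add_one K (n : ℤ)
      simp only [VV]; push_cast
      rw [show (n : ℤ) + 1 + 1 = n + 2 by ring, show (n : ℤ) + 2 - 1 = n + 1 by ring,
        show (n : ℤ) + 1 - 1 = n by ring, e1]
      linear_combination (-1 : K[X]) * e2
    have t1 := Chebyshev.T_add_two K (2 * (n : ℤ) + 1)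
    have t2 := Chebyshev.T_add_two K (2 * (n : ℤ) + 2)
    rw [show 2 * (n : ℤ) + 1 + 1 = 2 * n + 2 by ring] at t1
    rw [show 2 * (n : ℤ) + 2 + 1 = 2 * n + 1 + 2 by ring] at t2
    push_cast
    rw [show 2 * ((n : ℤ) + 1) + 1 = 2 * n + 1 + 2 by ring,
      show 2 * ((n : ℤ) + 1) + 2 = 2 * n + 2 + 2 by ring, hV]
    have t1' : Chebyshev.T K (2 * (n : ℤ) + 1 + 2) = (X + 1) * VV K (n+1) ^ 2 - 1 := by
      rw [t1, h2, h3]; linear_combination (-(X + 1) : K[X]) * h1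
    refine ⟨?_, t1', ?_⟩
    · linear_combination h1
    · rw [t2, t1', h3]; ring

theorem VV_D {K : Type*} [Field K] (n : ℕ) :
    (1 + X) * derivative (VV K n) =
      (n : K[X]) * Chebyshev.U K n + ((n : K[X]) + 1) * Chebyshev.U K ((n : ℤ) - 1) := by
  induction n using Nat.twoStepInduction with
  | zero => simp [VV]
  | one => simp [VV]; ring
  | more n h0 h1 =>
    have e1 := Chebyshev.U_add_two K (n : ℤ)
    have e2 := Chebyshev.U_add_one K (n : ℤ)
    have hV : VV K (n+2) = 2 * X * VV K (n+1) - VV K n := by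
      simp only [VV]; push_cast
      rw [show (n : ℤ) + 2 - 1 = n + 1 by ring,
        show (n : ℤ) + 1 - 1 = n by ring, e1]
      linear_combination (-1 : K[X]) * e2
    have hd : derivative (VV K (n+2)) = 2 * VV K (n+1) + 2 * X * derivative (VV K (n+1))
        - derivative (VV K n) := by
      rw [hV]; simp
    have hv : VV K (n+1) = Chebyshev.U K ((n : ℤ)+1) - Chebyshev.U K n := by
      simp [VV]
    rw [hd]
    push_cast at *
    rw [show (n : ℤ) + 1 - 1 = n by ring] at h1
    rw [show (n : ℤ) + 2 - 1 = n + 1 by ring, e1]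
    rw [hv] at *
    linear_combination 2 * X * h1 - h0 - ((n : K[X]) + 1) * e2

theorem VV_ODE {K : Type*} [Field K] (n : ℕ) :
    (1 - X ^ 2) * derivative (derivative (VV K n)) + (1 - 2 * X) * derivative (VV K n)
      + (n : K[X]) * ((n : K[X]) + 1) * VV K n = 0 := by
  have h := VV_D (K := K) n
  have u1 := Chebyshev.one_sub_X_sq_mul_derivative_derivative_U_eq_poly_in_U (R := K) (n : ℤ)
  have u2 := Chebyshev.one_sub_X_sq_mul_derivative_derivative_U_eq_poly_in_U (R := K) ((n : ℤ) - 1)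
  simp only [VV, derivative_sub, Function.iterate_succ, Function.iterate_zero,
    Function.comp, id] at *
  push_cast at *
  linear_combination u1 - u2 + h

theorem VV_coeff {K : Type*} [Field K] (n i : ℕ) :
    ((i : K) + 1) * (2 * i + 1) * ((VV K n).comp (X + 1)).coeff (i + 1) =
      ((n : K) - i) * (n + i + 1) * ((VV K n).comp (X + 1)).coeff i := by
  set t := (VV K n).comp (X + 1) with ht
  have d1 : derivative t = (derivative (VV K n)).comp (X + 1) := by
    simp [ht, derivative_comp]
  have d2 : derivative (derivative t) = (derivative (derivative (VV K n))).comp (X + 1) := by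
    simp [d1, derivative_comp]
  have h := congrArg (fun p => p.comp (X + 1)) (VV_ODE (K := K) n)
  simp only [add_comp, mul_comp, sub_comp, pow_comp, X_comp, one_comp, natCast_comp, ← d1, ← d2,
    ← ht, zero_comp, ofNat_comp] at h
  have h' : X * (X * derivative (derivative t)) + C 2 * (X * derivative (derivative t))
    + derivative t + C 2 * (X * derivative t) - C ((n : K) * ((n : K) + 1)) * t = 0 := by
    simp only [map_mul, map_add, map_one, map_natCast, map_ofNat]
    linear_combination -h
  have hc := congrArg (fun p => coeff p i) h'
  simp only [coeff_sub, coeff_add, coeff_C_mul, coeff_zero] at hc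
  rcases i with _ | _ | i
  · simp [coeff_derivative, mul_coeff_zero] at hc ⊢
    linear_combination hc
  · simp [coeff_X_mul, coeff_derivative, coeff_C_mul] at hc ⊢
    linear_combination hc
  · simp [coeff_X_mul, coeff_derivative, coeff_C_mul] at hc ⊢
    linear_combination hc

theorem square_patterns_stmt12 {K : Type*} [Field K] (d : ℕ) (hd : 3 ≤ d)
    (hodd : Odd d)
    (hchar : ringChar K = 0 ∨
      (Nat.Prime (ringChar K) ∧ Odd (ringChar K) ∧ d ≤ ringChar K))
    (A B : K) (hA : A ≠ 0) (g : K[X]) (hn : g.natDegree = (d - 1) / 2)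
    (ha0 : A * g.coeff 0 ^ 2 = -1)
    (hrec : ∀ i : ℕ, 1 ≤ i → i ≤ (d - 1) / 2 →
      (((i : ℤ) * (2 * (i : ℤ) - 1) : ℤ) : K) * B * g.coeff i =
        ((-(2 * ((((d - 1) / 2 : ℕ) : ℤ) - (i : ℤ) + 1) *
            ((((d - 1) / 2 : ℕ) : ℤ) + (i : ℤ))) : ℤ) : K) * g.coeff (i - 1))
    (f : K[X]) (hf : f = C A * (X - C B) * g ^ 2) :
    ∃ a b : K, a ≠ 0 ∧
      ((C a * X + C b).comp f).comp (C a⁻¹ * X - C (a⁻¹ * b)) =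
        -Polynomial.Chebyshev.T K (d : ℤ) := by
  obtain ⟨n, rfl⟩ := hodd
  have hdn : (2 * n + 1 - 1) / 2 = n := by omega
  rw [hdn] at hn
  simp only [hdn] at hrec
  have hne : ∀ m : ℕ, 0 < m → m < 2 * n + 1 → (m : K) ≠ 0 := by
    intro m h0 h1 h
    have := (ringChar.spec K m).1 h
    rcases hchar with h2 | ⟨_, _, h2⟩
    · rw [h2] at this; have := Nat.eq_zero_of_zero_dvd this; omega
    · have := Nat.le_of_dvd h0 this; omega
  have h2 : (2 : K) ≠ 0 := by exact_mod_cast hne 2 (by omega) (by omega)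
  have hg0 : g.coeff 0 ≠ 0 := by
    intro h; rw [h] at ha0; simp at ha0
  have hB : B ≠ 0 := by
    intro h
    have := hrec 1 le_rfl (by omega)
    rw [h] at this
    have e1 := hne n (by omega) (by omega)
    have e2 := hne (n+1) (by omega) (by omega)
    push_cast at this e2
    have h3 : 2 * (n : K) * (n + 1) * g.coeff 0 = 0 := by
      simp only [Nat.sub_self, mul_zero, zero_mul] at this
      linear_combination this
    simp [h2, e1, e2, hg0] at h3
  haveI : NeZero (2 : K) := ⟨h2⟩
  set c : K := -2 / B with hc
  have hcB : c * B = -2 := by rw [hc]; field_simp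
  have hc0 : c ≠ 0 := by rw [hc]; simp [h2, hB]
  set t := (VV K n).comp (X + 1) with ht
  have ht0 : t.coeff 0 = 1 := by
    rw [coeff_zero_eq_eval_zero, ht]; simp [VV]
  have htd : t.natDegree ≤ n := by
    have : (VV K n).natDegree ≤ n := by
      unfold VV
      refine (natDegree_sub_le _ _).trans (max_le ?_ ?_)
      · simp
      · rcases n with _ | n
        · simp
        · push_cast; rw [add_sub_cancel_right, Chebyshev.natDegree_U_natCast]; omega
    rw [ht]
    refine natDegree_comp_le.trans ?_
    have h1 : (X + 1 : K[X]).natDegree = 1 := by simpa using natDegree_X_add_C (1 : K)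
    rw [h1]; omega
  have key : ∀ i, i ≤ n → g.coeff i = g.coeff 0 * (t.coeff i * c ^ i) := by
    intro i
    induction i with
    | zero => simp [ht0]
    | succ i ih =>
      intro hi
      have r1 := hrec (i+1) (by omega) hi
      have r2 := VV_coeff (K := K) n i
      rw [← ht] at r2
      rw [Nat.add_sub_cancel, ih (by omega)] at r1
      have e1 := hne (i+1) (by omega) (by omega)
      have e2 := hne (2*i+1) (by omega) (by omega)
      push_cast at e1 e2 r1
      apply mul_left_cancel₀ (mul_ne_zero (mul_ne_zero e1 e2) hB)
      rw [pow_succ]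
      linear_combination r1 - (B * g.coeff 0 * c ^ i * c) * r2
        - (n - i) * (n + i + 1) * g.coeff 0 * t.coeff i * c ^ i * hcB
  have hg : g = C (g.coeff 0) * t.comp (C c * X) := by
    ext i
    rw [coeff_C_mul, comp_C_mul_X_coeff]
    by_cases hi : i ≤ n
    · exact key i hi
    · rw [coeff_eq_zero_of_natDegree_lt (by omega), coeff_eq_zero_of_natDegree_lt (p := t) (by omega)]
      simp
  have hT := (VV_T (K := K) n).2.1
  have hmain : (C c * X + C 1).comp f = (-Chebyshev.T K (2 * (n : ℤ) + 1)).comp (C c * X + C 1) := by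
    have htt : t.comp (C c * X) = (VV K n).comp (C c * X + 1) := by
      rw [ht, comp_assoc]; simp
    rw [hT, hf, hg, htt]
    have hA' : C A * C (g.coeff 0) ^ 2 = (-1 : K[X]) := by
      rw [← C_pow, ← C_mul, ha0]; simp
    have hB' : C c * C B = (-2 : K[X]) := by
      rw [← C_mul, hcB]; simp only [map_neg, map_ofNat]
    simp only [add_comp, mul_comp, C_comp, X_comp, neg_comp, sub_comp, pow_comp, one_comp, map_one]
    linear_combination (C c * (X - C B) * ((VV K n).comp (C c * X + 1)) ^ 2) * hA'
      + ((VV K n).comp (C c * X + 1)) ^ 2 * hB'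
  refine ⟨c, 1, hc0, ?_⟩
  rw [hmain, comp_assoc]
  have : (C c * X + C 1).comp (C c⁻¹ * X - C (c⁻¹ * 1)) = (X : K[X]) := by
    simp only [add_comp, mul_comp, C_comp, X_comp, mul_one, mul_sub, ← mul_assoc, ← C_mul,
      mul_inv_cancel₀ hc0]
    simp
  rw [this]; simp
end

section
/- Let q be an odd prime power and let f ∈ F_q[x] be a dynamically 2-ordinary polynomial of degree d ≥ 2. Then there exists a constant C > 0 depending only on d with the following property: for every a ∈ F_q, if the sequence (χ(f^ℓ(a)))_{ℓ≥1} is periodic with period m, then |O_f(a)| ≤ C · m · q^{(2·log₂(d)+1)/(2·log₂(d)+2)}. -/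
open Polynomial

lemma hasse_pow {F : Type*} [Field F] (f : F[X]) (N : ℕ) : ∀ k : ℕ, ∃ c : F[X],
    c.natDegree ≤ k * f.natDegree ∧ f ^ k * hasseDeriv k (f ^ N) = f ^ N * c := by
  have he : ∀ j : ℕ, ∃ e : F[X], e.natDegree ≤ j * f.natDegree ∧ f ^ j * hasseDeriv j f = f * e := by
    intro j
    rcases j with _ | j
    · exact ⟨1, by simp, by simp⟩
    · refine ⟨f ^ j * hasseDeriv (j+1) f, ?_, by ring⟩
      refine natDegree_mul_le.trans ?_
      have h1 := natDegree_hasseDeriv_le f (j+1)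
      have h2 : (f ^ j).natDegree ≤ j * f.natDegree := natDegree_pow_le
      rw [add_mul, one_mul]
      omega
  choose e he1 he2 using he
  induction N with
  | zero =>
    intro k
    rcases k with _ | k
    · exact ⟨1, by simp, by simp⟩
    · refine ⟨0, by simp, ?_⟩
      simp [hasseDeriv_apply_one]
  | succ N ih =>
    choose c hc1 hc2 using ih
    intro k
    refine ⟨∑ ij ∈ Finset.HasAntidiagonal.antidiagonal k, c ij.1 * e ij.2, ?_, ?_⟩
    · refine natDegree_sum_le_of_forall_le _ _ ?_
      intro ij hij
      rw [Finset.HasAntidiagonal.mem_antidiagonal] at hij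
      refine natDegree_mul_le.trans ?_
      rw [← hij, add_mul]
      exact add_le_add (hc1 _) (he1 _)
    · rw [pow_succ f N, hasseDeriv_mul, Finset.mul_sum, Finset.mul_sum]
      refine Finset.sum_congr rfl ?_
      intro ij hij
      rw [Finset.HasAntidiagonal.mem_antidiagonal] at hij
      have h1 := hc2 ij.1
      have h2 := he2 ij.2
      calc _ = (f ^ ij.1 * hasseDeriv ij.1 (f ^ N)) * (f ^ ij.2 * hasseDeriv ij.2 f) := by
            rw [← hij, pow_add]; ring
        _ = _ := by rw [h1, h2]; ring

lemma hasse_mul_X {F : Type*} [Field F] [Fintype F] (h : F[X]) (k : ℕ)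
    (hk : k < Fintype.card F) :
    hasseDeriv k (h * X ^ (Fintype.card F)) = hasseDeriv k h * X ^ (Fintype.card F) := by
  obtain ⟨p, hp⟩ := CharP.exists F
  obtain ⟨n, hpr, hn⟩ := FiniteField.card F p
  rw [hasseDeriv_mul, Finset.sum_eq_single (k, 0)]
  · simp
  · rintro ⟨i, j⟩ hij hne
    rw [Finset.HasAntidiagonal.mem_antidiagonal] at hij
    simp only at hij
    have hj0 : j ≠ 0 := by
      rintro rfl
      apply hne
      simp at hij; rw [hij]
    have hz : hasseDeriv j ((X : F[X]) ^ (Fintype.card F)) = 0 := by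
      rw [← monomial_one_right_eq_X_pow, hasseDeriv_monomial]
      have : ((Fintype.card F).choose j : F) = 0 := by
        rw [CharP.cast_eq_zero_iff F p, hn]
        apply hpr.dvd_choose_pow hj0
        omega
      simp [this]
    simp [hz]
  · intro h; simp at h

lemma hasse_mul_X' {F : Type*} [Field F] [Fintype F] (h : F[X]) (k : ℕ)
    (hk : k < Fintype.card F) (j : ℕ) :
    hasseDeriv k (h * X ^ (j * Fintype.card F)) = hasseDeriv k h * X ^ (j * Fintype.card F) := by
  induction j with
  | zero => simp
  | succ j ih =>
    rw [add_mul, one_mul, pow_add, ← mul_assoc, hasse_mul_X _ _ hk, ih, mul_assoc]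

lemma exists_aux {F : Type*} [Field F] {ι : Type*} [Fintype ι] (M A B : ℕ)
    (T : Fin M → ι → (F[X] →ₗ[F] F[X]))
    (hT : ∀ k i (h : F[X]), h.degree < (A : WithBot ℕ) → (T k i h).degree < (B : WithBot ℕ))
    (hc : M * B < Fintype.card ι * A) :
    ∃ v : ι → F[X], (∃ i, v i ≠ 0) ∧ (∀ i, (v i).degree < (A : WithBot ℕ)) ∧
      ∀ k, ∑ i, T k i (v i) = 0 := by
  classical
  let Φ : (ι → degreeLT F A) →ₗ[F] (Fin M → Fin B → F) :=
    LinearMap.pi fun k => LinearMap.pi fun b =>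
      (lcoeff F (b : ℕ)) ∘ₗ
        (∑ i, (T k i) ∘ₗ (degreeLT F A).subtype ∘ₗ (LinearMap.proj i))
  have hfr : Module.finrank F (degreeLT F A) = A := by
    rw [(degreeLTEquiv F A).finrank_eq]; simp
  have : Module.Finite F (degreeLT F A) := Module.Finite.equiv (degreeLTEquiv F A).symm
  have hlt : Module.finrank F (Fin M → Fin B → F) < Module.finrank F (ι → degreeLT F A) := by
    have e1 : Module.finrank F (ι → degreeLT F A) = Fintype.card ι * A := by
      rw [Module.finrank_pi_fintype]; simp only [hfr]; simp
    have e2 : Module.finrank F (Fin M → Fin B → F) = M * B := by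
      rw [Module.finrank_pi_fintype]; simp
    rw [e1, e2]
    exact hc
  have hker := LinearMap.ker_ne_bot_of_finrank_lt (f := Φ) hlt
  obtain ⟨v, hv, hv0⟩ := Submodule.exists_mem_ne_zero_of_ne_bot hker
  refine ⟨fun i => (v i : F[X]), ?_, fun i => mem_degreeLT.1 (v i).2, ?_⟩
  · by_contra hcon
    push Not at hcon
    apply hv0
    funext i
    exact Subtype.ext (hcon i)
  · intro k
    ext b
    rw [LinearMap.mem_ker] at hv
    by_cases hb : b < B
    · have := congrFun (congrFun hv k) ⟨b, hb⟩
      simpa [Φ] using this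
    · rw [coeff_eq_zero_of_degree_lt]
      · simp
      · refine lt_of_lt_of_le (lt_of_le_of_lt (degree_sum_le _ _) ?_) (Nat.cast_le.2 (not_lt.1 hb))
        rw [Finset.sup_lt_iff (WithBot.bot_lt_coe _)]
        intro i _
        exact hT _ _ _ (mem_degreeLT.1 (v i).2)

lemma card_mul_le {F : Type*} [Field F] (r : F[X]) (hr : r ≠ 0) (M : ℕ) (S : Finset F)
    (h : ∀ x ∈ S, ∀ k < M, (hasseDeriv k r).eval x = 0) : M * S.card ≤ r.natDegree := by
  classical
  have h1 : ∀ x ∈ S, M ≤ r.roots.count x := by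
    intro x hx
    rw [count_roots, le_rootMultiplicity_iff hr]
    have h2 : (X : F[X]) ^ M ∣ taylor x r := by
      rw [X_pow_dvd_iff]
      intro k hk
      rw [taylor_coeff]; exact h x hx k hk
    obtain ⟨u, hu⟩ := h2
    refine ⟨taylor (-x) u, ?_⟩
    have := congrArg (taylor (-x)) hu
    rw [taylor_taylor] at this
    simp [taylor_mul, taylor_pow] at this
    rw [this, sub_eq_add_neg]
  calc M * S.card = ∑ x ∈ S, M := by simp [mul_comm]
    _ ≤ ∑ x ∈ S, r.roots.count x := Finset.sum_le_sum h1
    _ ≤ r.roots.card := by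
      have := Multiset.sum_count_eq_card (s := S ∪ r.roots.toFinset) (m := r.roots) (by intro a ha; simp; right; simpa using ha)
      rw [← this]
      exact Finset.sum_le_sum_of_subset Finset.subset_union_left
    _ ≤ _ := card_roots' r

lemma nd_lt {F : Type*} [Field F] {p : F[X]} {A : ℕ} (hA : 0 < A)
    (h : p.degree < (A : WithBot ℕ)) : p.natDegree < A := by
  by_cases hp : p = 0
  · simpa [hp] using hA
  · exact (natDegree_lt_iff_degree_lt hp).2 h

lemma nonvanish_s13 {F : Type*} [Field F] [Fintype F] (hq : Odd (Fintype.card F)) (f : F[X])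
    (h0 : f.eval 0 ≠ 0)
    (hns : ∀ (r s : F[X]) (c : F), c ≠ 0 → f * r ^ 2 = C c * s ^ 2 → r = 0)
    (A J : ℕ) (hA0 : 0 < A) (hA : 2 * A + f.natDegree ≤ Fintype.card F) (r s : ℕ → F[X])
    (hr : ∀ j, (r j).degree < (A : WithBot ℕ)) (hs : ∀ j, (s j).degree < (A : WithBot ℕ))
    (hsum : ∑ j ∈ Finset.range J,
      (r j + s j * f ^ (Fintype.card F / 2)) * X ^ (j * Fintype.card F) = 0) :
    ∀ j < J, r j = 0 ∧ s j = 0 := by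
  set q := Fintype.card F with hqdef
  have hcf : f.coeff 0 ≠ 0 := by rwa [coeff_zero_eq_eval_zero]
  intro j
  induction j using Nat.strong_induction_on with
  | _ j ih =>
  intro hj
  have hdiv : (X : F[X]) ^ q ∣ r j + s j * f ^ (q / 2) := by
    have h1 : (X : F[X]) ^ ((j + 1) * q) ∣ (r j + s j * f ^ (q / 2)) * X ^ (j * q) := by
      rw [← Finset.add_sum_erase _ _ (Finset.mem_range.2 hj)] at hsum
      rw [eq_neg_of_add_eq_zero_left hsum, dvd_neg]
      refine Finset.dvd_sum ?_
      intro i hi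
      rw [Finset.mem_erase, Finset.mem_range] at hi
      rcases lt_or_gt_of_ne hi.1 with h | h
      · obtain ⟨a, b⟩ := ih i h hi.2
        simp [a, b]
      · refine Dvd.dvd.mul_left (pow_dvd_pow _ ?_) _
        exact Nat.mul_le_mul_right _ h
    rw [add_mul, one_mul, pow_add, mul_comm] at h1
    exact (mul_dvd_mul_iff_right (pow_ne_zero _ X_ne_zero)).1 h1
  obtain ⟨p, hp⟩ := CharP.exists F
  obtain ⟨n, hpr, hn⟩ := FiniteField.card F p
  have := Fact.mk hpr
  have hfq : (X : F[X]) ^ q ∣ f ^ q - C (f.coeff 0) := by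
    have h1 : f ^ q - C (f.coeff 0) = (f - C (f.coeff 0)) ^ q := by
      rw [hqdef, hn, sub_pow_char_pow, ← hn, ← C_pow, FiniteField.pow_card]
    rw [h1]
    apply pow_dvd_pow_of_dvd
    rw [X_dvd_iff]; simp
  have hqq : q = 1 + 2 * (q / 2) := by
    obtain ⟨t, ht⟩ := hq; omega
  have hd2 : (X : F[X]) ^ q ∣ f * (r j) ^ 2 - C (f.coeff 0) * (s j) ^ 2 := by
    have : f * (r j) ^ 2 - C (f.coeff 0) * (s j) ^ 2 =
        (r j + s j * f ^ (q / 2)) * (f * (r j - s j * f ^ (q/2))) +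
          (f ^ q - C (f.coeff 0)) * (s j) ^ 2 := by
      have : f ^ q = f * (f ^ (q / 2)) ^ 2 := by
        conv_lhs => rw [hqq]
        rw [pow_add, pow_one, mul_comm 2, pow_mul]
      rw [this]; ring
    rw [this]
    exact dvd_add (Dvd.dvd.mul_right hdiv _) (Dvd.dvd.mul_right hfq _)
  have hz : f * (r j) ^ 2 - C (f.coeff 0) * (s j) ^ 2 = 0 := by
    by_contra hne
    have h1 := natDegree_le_of_dvd hd2 hne
    rw [natDegree_X_pow] at h1
    have h2 := nd_lt hA0 (hr j)
    have h3 := nd_lt hA0 (hs j)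
    have h4 : (f * (r j) ^ 2).natDegree ≤ f.natDegree + 2 * (r j).natDegree :=
      natDegree_mul_le.trans (add_le_add le_rfl natDegree_pow_le)
    have h5 : (C (f.coeff 0) * (s j) ^ 2).natDegree ≤ 2 * (s j).natDegree :=
      (natDegree_C_mul_le _ _).trans natDegree_pow_le
    have h6 := natDegree_sub_le (f * (r j) ^ 2) (C (f.coeff 0) * (s j) ^ 2)
    have h7 := max_le_max h4 h5
    have h8 := h1.trans (h6.trans h7)
    rcases le_max_iff.1 h8 with h | h <;> omega
  have hrz := hns (r j) (s j) _ hcf (sub_eq_zero.1 hz)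
  refine ⟨hrz, ?_⟩
  rw [hrz] at hz
  simpa [hcf] using hz

lemma step_abs {F : Type*} [Field F] [Fintype F] [DecidableEq F] (hq : Odd (Fintype.card F))
    (f : F[X]) (h0 : f.eval 0 ≠ 0)
    (hns : ∀ (r s : F[X]) (c : F), c ≠ 0 → f * r ^ 2 = C c * s ^ 2 → r = 0)
    (a : F) (ha : a ≠ 0)
    (A J M : ℕ) (hA0 : 0 < A) (hA : 2 * A + f.natDegree ≤ Fintype.card F)
    (hM : M ≤ Fintype.card F)
    (hc : M * (A + M * f.natDegree + J) < 2 * J * A) :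
    M * (Finset.univ.filter fun x : F => (f.eval x) ^ (Fintype.card F / 2) = a).card ≤
      A + f.natDegree * (Fintype.card F / 2) + (J - 1) * Fintype.card F := by
  set q := Fintype.card F with hqdef
  choose c hc1 hc2 using hasse_pow f (q / 2)
  let T : Fin M → (Fin J ⊕ Fin J) → (F[X] →ₗ[F] F[X]) := fun k i =>
    Sum.elim
      (fun j : Fin J => LinearMap.mulLeft F (f ^ (k : ℕ) * X ^ (j : ℕ)) ∘ₗ hasseDeriv (k : ℕ))
      (fun j : Fin J => ∑ il ∈ Finset.HasAntidiagonal.antidiagonal (k : ℕ),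
        LinearMap.mulLeft F (C a * (c il.1 * f ^ il.2) * X ^ (j : ℕ)) ∘ₗ hasseDeriv il.2) i
  obtain ⟨v, ⟨i0, hv0⟩, hvd, hvT⟩ := exists_aux M A (A + M * f.natDegree + J) T (by
      intro k i h hh
      have hkM : (k : ℕ) * f.natDegree ≤ M * f.natDegree := Nat.mul_le_mul_right _ k.2.le
      have hnd := nd_lt hA0 hh
      have key : (T k i h).natDegree < A + M * f.natDegree + J := by
        rcases i with j | j
        · simp only [T, Sum.elim_inl, LinearMap.comp_apply, LinearMap.mulLeft_apply]
          have e1 : (f ^ (k : ℕ) * X ^ (j : ℕ) * hasseDeriv (k : ℕ) h).natDegree ≤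
              ((k : ℕ) * f.natDegree + j) + h.natDegree := by
            refine natDegree_mul_le.trans (add_le_add (natDegree_mul_le.trans
              (add_le_add natDegree_pow_le (natDegree_X_pow_le _))) ?_)
            exact (natDegree_hasseDeriv_le h _).trans (Nat.sub_le _ _)
          have := j.2
          omega
        · simp only [T, Sum.elim_inr, LinearMap.sum_apply, LinearMap.comp_apply,
            LinearMap.mulLeft_apply]
          have e1 : (∑ il ∈ Finset.HasAntidiagonal.antidiagonal (k : ℕ),
              C a * (c il.1 * f ^ il.2) * X ^ (j : ℕ) * hasseDeriv il.2 h).natDegree ≤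
              ((k : ℕ) * f.natDegree + j) + h.natDegree := by
            refine natDegree_sum_le_of_forall_le _ _ ?_
            intro il hil
            rw [Finset.HasAntidiagonal.mem_antidiagonal] at hil
            refine natDegree_mul_le.trans (add_le_add (natDegree_mul_le.trans
              (add_le_add ((natDegree_C_mul_le _ _).trans (natDegree_mul_le.trans ?_))
                (natDegree_X_pow_le _))) ?_)
            · rw [← hil, add_mul]
              exact add_le_add (hc1 _) natDegree_pow_le
            · exact (natDegree_hasseDeriv_le h _).trans (Nat.sub_le _ _)
          have := j.2
          omega
      by_cases hz : T k i h = 0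
      · rw [hz, degree_zero]; exact WithBot.bot_lt_coe _
      · exact (natDegree_lt_iff_degree_lt hz).1 key) (by
      simp only [Fintype.card_sum, Fintype.card_fin]
      rw [← two_mul]; exact hc)
  let r : ℕ → F[X] := fun j => if h : j < J then v (Sum.inl ⟨j, h⟩) else 0
  let s : ℕ → F[X] := fun j => if h : j < J then v (Sum.inr ⟨j, h⟩) else 0
  have hrd : ∀ j, (r j).degree < (A : WithBot ℕ) := by
    intro j; simp only [r]; split_ifs
    · exact hvd _
    · rw [degree_zero]; exact WithBot.bot_lt_coe _
  have hsd : ∀ j, (s j).degree < (A : WithBot ℕ) := by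
    intro j; simp only [s]; split_ifs
    · exact hvd _
    · rw [degree_zero]; exact WithBot.bot_lt_coe _
  set R : F[X] := ∑ j ∈ Finset.range J, (r j + s j * f ^ (q / 2)) * X ^ (j * q) with hR
  have hR0 : R ≠ 0 := by
    intro hz
    have := nonvanish_s13 hq f h0 hns A J hA0 hA r s hrd hsd hz
    apply hv0
    rcases i0 with j | j
    · have := (this j j.2).1
      simpa [r] using this
    · have := (this j j.2).2
      simpa [s] using this
  have hRd : R.natDegree ≤ A + f.natDegree * (q / 2) + (J - 1) * q := by
    refine natDegree_sum_le_of_forall_le _ _ ?_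
    intro j hj
    rw [Finset.mem_range] at hj
    refine natDegree_mul_le.trans (add_le_add (natDegree_add_le_of_degree_le ?_ ?_) ?_)
    · have := nd_lt hA0 (hrd j); omega
    · refine natDegree_mul_le.trans (add_le_add (nd_lt hA0 (hsd j)).le ?_)
      rw [mul_comm]; exact natDegree_pow_le
    · refine (natDegree_X_pow_le _).trans (Nat.mul_le_mul_right _ (by omega))
  refine (card_mul_le R hR0 M _ ?_).trans hRd
  intro x hx k hk
  rw [Finset.mem_filter] at hx
  have hx := hx.2
  have hfx : f.eval x ≠ 0 := by
    intro h
    rw [h, zero_pow] at hx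
    · exact ha hx.symm
    · intro h2
      have : 1 < q := Fintype.one_lt_card
      omega
  have hmul : (f ^ k * hasseDeriv k R).eval x = 0 := by
    have h1 : (∑ i, T ⟨k, hk⟩ i (v i)).eval x = 0 := by rw [hvT]; simp
    rw [← h1, Fintype.sum_sum_type, ← Finset.sum_add_distrib, eval_finsetSum, hR, map_sum,
      Finset.mul_sum, eval_finsetSum, Finset.sum_range]
    refine Finset.sum_congr rfl ?_
    intro j _
    have hrj : r j = v (Sum.inl j) := by simp [r]
    have hsj : s j = v (Sum.inr j) := by simp [s]
    rw [hqdef, hasse_mul_X' _ _ (lt_of_lt_of_le hk hM), ← hqdef]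
    have h2 : f ^ k * hasseDeriv k (s j * f ^ (q / 2)) =
        f ^ (q / 2) * ∑ il ∈ Finset.HasAntidiagonal.antidiagonal k,
          c il.1 * f ^ il.2 * hasseDeriv il.2 (s j) := by
      rw [mul_comm (s j), hasseDeriv_mul, Finset.mul_sum, Finset.mul_sum]
      refine Finset.sum_congr rfl ?_
      intro il hil
      rw [Finset.HasAntidiagonal.mem_antidiagonal] at hil
      calc _ = (f ^ il.1 * hasseDeriv il.1 (f ^ (q / 2))) * (f ^ il.2 * hasseDeriv il.2 (s j)) := by
            rw [← hil, pow_add]; ring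
        _ = _ := by rw [hc2]; ring
    have h3 : (X ^ ((j : ℕ) * q) : F[X]).eval x = x ^ (j : ℕ) := by
      rw [eval_pow, eval_X, mul_comm, pow_mul, hqdef, FiniteField.pow_card]
    rw [map_add, ← mul_assoc, mul_add, h2, eval_mul, h3, eval_add, eval_mul, eval_pow, eval_mul,
      eval_pow, hx]
    simp only [T, Sum.elim_inl, Sum.elim_inr, LinearMap.sum_apply, LinearMap.comp_apply,
            LinearMap.mulLeft_apply, ← hrj, ← hsj, eval_add, eval_mul, eval_pow, eval_X, eval_C,
            eval_finsetSum]
    rw [add_mul, Finset.mul_sum, Finset.sum_mul]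
    congr 1
    · ring
    · refine Finset.sum_congr rfl ?_
      intro il _
      ring
  rw [eval_mul, eval_pow] at hmul
  exact (mul_eq_zero.1 hmul).resolve_left (pow_ne_zero _ hfx)

lemma step_zero {F : Type*} [Field F] [Fintype F] [DecidableEq F] (hq : Odd (Fintype.card F))
    (f : F[X]) (h0 : f.eval 0 ≠ 0) (hm : 1 ≤ f.natDegree)
    (hns : ∀ (r s : F[X]) (c : F), c ≠ 0 → f * r ^ 2 = C c * s ^ 2 → r = 0)
    (a : F) (ha : a ≠ 0) (hbig : 784 * f.natDegree ^ 2 ≤ Fintype.card F) :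
    ((Finset.univ.filter fun x : F => (f.eval x) ^ (Fintype.card F / 2) = a).card : ℝ) ≤
      (Fintype.card F : ℝ) / 2 + 14 * f.natDegree * √(Fintype.card F : ℝ) := by
  have habs := step_abs hq f h0 hns a ha
  set N := (Finset.univ.filter fun x : F => (f.eval x) ^ (Fintype.card F / 2) = a).card
  generalize Fintype.card F = q at *
  generalize f.natDegree = m at *
  set L := Nat.sqrt q with hL
  have hL1 : L * L ≤ q := Nat.sqrt_le q
  have hL2 : q < (L + 1) * (L + 1) := Nat.lt_succ_sqrt q
  have hL3 : 28 * m ≤ L := by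
    rw [hL, Nat.le_sqrt]; nlinarith
  obtain ⟨A, hA⟩ : ∃ A, A = (q - m) / 2 := ⟨_, rfl⟩
  have hLm : 28 ≤ L := by omega
  have hLL : 28 * L ≤ L * L := Nat.mul_le_mul_right _ hLm
  have hA1 : 2 * A + m ≤ q := by omega
  have hA2 : q ≤ 2 * A + m + 1 := by omega
  have h3 : 3 * (L * L) + 13 * L < 13 * A := by omega
  have := habs A (L + 13 * m) (2 * L) (by omega) hA1 (by omega) (by
    have h4 : m * (3 * (L * L) + 13 * L) < m * (13 * A) := Nat.mul_lt_mul_of_pos_left h3 hm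
    have h5 : L * L ≤ m * (L * L) := Nat.le_mul_of_pos_left _ hm
    nlinarith)
  have hfin : 4 * L * N ≤ 2 * (L + 13 * m) * q + m * q := by
    have e1 : 2 * (m * (q / 2)) ≤ m * q := by
      have : 2 * (q / 2) ≤ q := by omega
      nlinarith
    have e2 : (L + 13 * m - 1) * q + q = (L + 13 * m) * q := by
      rw [← Nat.succ_mul]; congr 1; omega
    nlinarith
  have hfinR : (4 * L * N : ℝ) ≤ 2 * (L + 13 * m) * q + m * q := by exact_mod_cast hfin
  have hLpos : (0 : ℝ) < L := by exact_mod_cast (by omega : 0 < L)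
  have hs0 : 0 ≤ √(q : ℝ) := Real.sqrt_nonneg _
  have hs2 : √(q : ℝ) * √(q : ℝ) = q := Real.mul_self_sqrt (by positivity)
  have hsL : √(q : ℝ) ≤ 2 * L := by
    rw [Real.sqrt_le_left (by positivity)]
    have : q ≤ (2 * L) ^ 2 := by nlinarith
    exact_mod_cast this
  have hqL : (q : ℝ) ≤ 2 * L * √(q : ℝ) := by nlinarith
  have hmq : (m : ℝ) * q ≤ m * (2 * L * √(q : ℝ)) := by gcongr
  have hp : 0 ≤ (m : ℝ) * (L * √(q : ℝ)) := by positivity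
  have : (4 * L : ℝ) * N ≤ 4 * L * ((q : ℝ) / 2 + 14 * m * √(q : ℝ)) := by nlinarith
  exact le_of_mul_le_mul_left this (by positivity)

lemma step_full {F : Type*} [Field F] [Fintype F] [DecidableEq F] (hq : Odd (Fintype.card F))
    (f : F[X]) (hm : 1 ≤ f.natDegree)
    (hns : ∀ (r s : F[X]) (c : F), c ≠ 0 → f * r ^ 2 = C c * s ^ 2 → r = 0)
    (a : F) (ha : a ≠ 0) :
    ((Finset.univ.filter fun x : F => (f.eval x) ^ (Fintype.card F / 2) = a).card : ℝ) ≤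
      (Fintype.card F : ℝ) / 2 + 14 * f.natDegree * √(Fintype.card F : ℝ) := by
  by_cases hbig : 784 * f.natDegree ^ 2 ≤ Fintype.card F
  · have hf0 : f ≠ 0 := by rintro rfl; simp at hm
    obtain ⟨t, ht⟩ : ∃ t : F, f.eval t ≠ 0 := by
      by_contra hcon
      push Not at hcon
      have := card_le_degree_of_subset_roots (p := f) (Z := Finset.univ) (by
        intro x _
        simp [hf0, hcon x])
      rw [Finset.card_univ] at this
      nlinarith
    have := step_zero hq (taylor t f) (by simpa [taylor_eval] using ht) (by simpa using hm) (by
      intro r s c hc h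
      have h2 := congrArg (taylor (-t)) h
      simp only [taylor_mul, taylor_pow, taylor_taylor, taylor_C] at h2
      rw [neg_add_cancel, taylor_zero] at h2
      have := hns _ _ c hc h2
      exact (taylor_eq_zero _ _).1 this) a ha (by simpa using hbig)
    rw [natDegree_taylor] at this
    refine le_trans (le_of_eq ?_) this
    norm_cast
    refine Finset.card_bij (fun x _ => x - t) ?_ ?_ ?_
    · intro x hx; simpa [taylor_eval] using hx
    · intro x _ y _ h; simpa using h
    · intro x hx
      exact ⟨x + t, by simpa [taylor_eval] using hx, by simp⟩
  · push Not at hbig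
    have h1 : ((Finset.univ.filter fun x : F => (f.eval x) ^ (Fintype.card F / 2) = a).card : ℝ) ≤ Fintype.card F := by
      exact_mod_cast Finset.card_le_univ _
    generalize Fintype.card F = q at *
    have h2 : √(q : ℝ) ≤ 28 * f.natDegree := by
      rw [Real.sqrt_le_left (by positivity)]
      have : q ≤ (28 * f.natDegree) ^ 2 := by nlinarith
      exact_mod_cast this
    have hs0 : 0 ≤ √(q : ℝ) := Real.sqrt_nonneg _
    have hs2 : √(q : ℝ) * √(q : ℝ) = q := Real.mul_self_sqrt (by positivity)
    nlinarith

lemma weil {F : Type*} [Field F] [Fintype F] [DecidableEq F] (hq : Odd (Fintype.card F))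
    (f : F[X]) (hm : 1 ≤ f.natDegree)
    (hns : ∀ (r s : F[X]) (c : F), c ≠ 0 → f * r ^ 2 = C c * s ^ 2 → r = 0) :
    |((∑ x : F, quadraticChar F (f.eval x) : ℤ) : ℝ)| ≤
      29 * f.natDegree * √(Fintype.card F : ℝ) := by
  have hchar : ringChar F ≠ 2 := by
    intro h
    have := FiniteField.even_card_iff_char_two.1 h
    rw [Nat.odd_iff] at hq; omega
  have hf0 : f ≠ 0 := by rintro rfl; simp at hm
  have hP := step_full hq f hm hns 1 one_ne_zero
  have hQ := step_full hq f hm hns (-1) (by simp)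
  set P := (Finset.univ.filter fun x : F => (f.eval x) ^ (Fintype.card F / 2) = 1)
  set Q := (Finset.univ.filter fun x : F => (f.eval x) ^ (Fintype.card F / 2) = -1)
  set Z := (Finset.univ.filter fun x : F => f.eval x = 0) with hZdef
  have h11 : (1 : F) ≠ -1 := by
    intro h; exact Ring.neg_one_ne_one_of_char_ne_two hchar h.symm
  have hpos : Fintype.card F / 2 ≠ 0 := by
    have : 1 < Fintype.card F := Fintype.one_lt_card
    omega
  have hsum : (∑ x : F, quadraticChar F (f.eval x) : ℤ) = P.card - Q.card := by
    simp only [P, Q, Finset.card_filter]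
    push_cast
    rw [← Finset.sum_sub_distrib]
    refine Finset.sum_congr rfl ?_
    intro x _
    by_cases h : f.eval x = 0
    · simp [h, hpos]
    · rw [quadraticChar_eq_pow_of_char_ne_two hchar h]
      rcases FiniteField.pow_dichotomy hchar h with h | h <;> simp [h, h11, h11.symm]
  have hcard : (P.card + Q.card + Z.card : ℕ) = Fintype.card F := by
    simp only [P, Q, Z, Finset.card_filter]
    rw [← Finset.sum_add_distrib, ← Finset.sum_add_distrib, ← Finset.card_univ,
      Finset.card_eq_sum_ones]
    refine Finset.sum_congr rfl ?_
    intro x _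
    by_cases h : f.eval x = 0
    · simp [h, hpos]
    · rcases FiniteField.pow_dichotomy hchar h with h' | h' <;> simp [h', h, h11, h11.symm]
  have hZ : Z.card ≤ f.natDegree := by
    refine card_le_degree_of_subset_roots ?_
    intro x hx
    simpa [hf0, hZdef] using hx
  have hcardR : (P.card + Q.card + Z.card : ℝ) = Fintype.card F := by exact_mod_cast hcard
  have hZR : (Z.card : ℝ) ≤ f.natDegree := by exact_mod_cast hZ
  have hs1 : 1 ≤ √(Fintype.card F : ℝ) := by
    rw [Real.one_le_sqrt]
    exact_mod_cast Fintype.card_pos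
  have hms : (f.natDegree : ℝ) ≤ f.natDegree * √(Fintype.card F : ℝ) :=
    le_mul_of_one_le_right (by positivity) hs1
  rw [hsum]
  push_cast
  rw [abs_le]
  constructor <;> linarith

lemma iter_eval {F : Type*} [Field F] (f : F[X]) (n : ℕ) (y : F) :
    (polyIter f n).eval y = (fun x => f.eval x)^[n] y := by
  induction n with
  | zero => simp [polyIter]
  | succ n ih => rw [polyIter, eval_comp, ih, Function.iterate_succ_apply']

lemma iter_deg {F : Type*} [Field F] (f : F[X]) (n : ℕ) :
    (polyIter f n).natDegree = f.natDegree ^ n := by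
  induction n with
  | zero => simp [polyIter]
  | succ n ih => rw [polyIter, natDegree_comp, ih, pow_succ, mul_comm]

lemma nonsq {F : Type*} [Field F] (f : F[X]) (hd : 1 ≤ f.natDegree) (hf : DynTwoOrdinary f)
    (K : ℕ) (S : Finset ℕ) (hS : S ⊆ Finset.Icc 1 K) (hne : S.Nonempty) :
    ∀ (r s : F[X]) (c : F), c ≠ 0 → (∏ i ∈ S, polyIter f i) * r ^ 2 = C c * s ^ 2 → r = 0 := by
  intro r s c hc h
  by_contra hr
  have hn := S.max'_mem hne
  set n := S.max' hne with hndef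
  have hn1 := (Finset.mem_Icc.1 (hS hn)).1
  obtain ⟨g, hg, ⟨e, ho, he1, he2⟩, hi⟩ := hf n hn1
  have hgp : Prime g := hg.prime
  have hnz : ∀ i, polyIter f i ≠ 0 := by
    intro i hz
    have := iter_deg f i
    rw [hz, natDegree_zero] at this
    have : 0 < f.natDegree ^ i := by positivity
    omega
  have hP0 : (∏ i ∈ S, polyIter f i) ≠ 0 := Finset.prod_ne_zero_iff.2 fun i _ => hnz i
  have hs : s ≠ 0 := by
    rintro rfl
    have : (∏ i ∈ S, polyIter f i) * r ^ 2 = 0 := by rw [h]; simp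
    exact (mul_ne_zero hP0 (pow_ne_zero 2 hr)) this
  have hnd : ¬ g ∣ ∏ i ∈ S.erase n, polyIter f i := by
    rw [hgp.dvd_finsetProd_iff]
    rintro ⟨i, hiS, hgi⟩
    rw [Finset.mem_erase] at hiS
    exact hi i (lt_of_le_of_ne (S.le_max' i hiS.2) hiS.1) hgi
  have hcu : emultiplicity g (C c) = 0 := by
    rw [emultiplicity_eq_zero]
    intro hdv
    exact hg.not_isUnit (isUnit_of_dvd_unit hdv (isUnit_C.2 hc.isUnit))
  have h1 := congrArg (emultiplicity g) h
  rw [← Finset.mul_prod_erase S _ hn, emultiplicity_mul hgp, emultiplicity_mul hgp,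
    emultiplicity_mul hgp, emultiplicity_pow hgp, emultiplicity_pow hgp,
    emultiplicity_eq_coe.2 ⟨he1, he2⟩, emultiplicity_eq_zero.2 hnd, hcu,
    (FiniteMultiplicity.of_prime_left hgp hr).emultiplicity_eq_multiplicity,
    (FiniteMultiplicity.of_prime_left hgp hs).emultiplicity_eq_multiplicity] at h1
  have h2 : e + 0 + 2 * multiplicity g r = 0 + 2 * multiplicity g s := by exact_mod_cast h1
  obtain ⟨t, ht⟩ := ho
  omega

lemma geom_sum_le_aux (d K : ℕ) (hd : 2 ≤ d) : ∑ i ∈ Finset.Icc 1 K, d ^ i ≤ 2 * d ^ K := by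
  induction K with
  | zero => simp
  | succ K ih =>
    rw [Finset.sum_Icc_succ_top (by omega)]
    have : 2 * d ^ K ≤ d ^ (K + 1) := by
      rw [pow_succ, mul_comm]; exact Nat.mul_le_mul_left _ hd
    omega

lemma pattern {F : Type*} [Field F] [Fintype F] [DecidableEq F] (hq : Odd (Fintype.card F))
    (f : F[X]) (hd : 2 ≤ f.natDegree) (hf : DynTwoOrdinary f) (K : ℕ) (ε : ℕ → ℤ)
    (T : Finset F) (hT : ∀ y ∈ T, ∀ i ∈ Finset.Icc 1 K,
        quadraticChar F ((polyIter f i).eval y) = ε i) :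
    (T.card : ℝ) ≤
      (Fintype.card F : ℝ) / 2 ^ K + 58 * (f.natDegree : ℝ) ^ K * √(Fintype.card F : ℝ) := by
  have hs1 : 1 ≤ √(Fintype.card F : ℝ) := by
    rw [Real.one_le_sqrt]
    exact_mod_cast Fintype.card_pos
  have hdK : (0 : ℝ) < (f.natDegree : ℝ) ^ K := by positivity
  rcases T.eq_empty_or_nonempty with hE | ⟨y0, hy0⟩
  · rw [hE]; simp; positivity
  by_cases hz : ∃ i ∈ Finset.Icc 1 K, ε i = 0
  · obtain ⟨i, hi, hiz⟩ := hz
    have hnz : polyIter f i ≠ 0 := by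
      intro hz
      have := iter_deg f i
      rw [hz, natDegree_zero] at this
      have : 0 < f.natDegree ^ i := by positivity
      omega
    have h1 : T.card ≤ (polyIter f i).natDegree := by
      refine card_le_degree_of_subset_roots ?_
      intro y hy
      have := hT y hy i hi
      rw [hiz, quadraticChar_eq_zero_iff] at this
      simp [hnz, this]
    rw [iter_deg] at h1
    have h2 : T.card ≤ f.natDegree ^ K :=
      h1.trans (Nat.pow_le_pow_right (by omega) (Finset.mem_Icc.1 hi).2)
    have h3 : (T.card : ℝ) ≤ (f.natDegree : ℝ) ^ K := by exact_mod_cast h2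
    have h4 : (f.natDegree : ℝ) ^ K ≤ (f.natDegree : ℝ) ^ K * √(Fintype.card F : ℝ) :=
      le_mul_of_one_le_right hdK.le hs1
    have h5 : (0:ℝ) ≤ (Fintype.card F : ℝ) / 2 ^ K := by positivity
    nlinarith
  push Not at hz
  have hε : ∀ i ∈ Finset.Icc 1 K, ε i = 1 ∨ ε i = -1 := by
    intro i hi
    have h := hT y0 hy0 i hi
    rw [← h]
    apply quadraticChar_dichotomy
    intro h0
    rw [h0, quadraticChar_zero] at h
    exact hz i hi h.symm
  set χ := quadraticChar F
  have hχ : ∀ x : F, χ x = 0 ∨ χ x = 1 ∨ χ x = -1 := fun x => quadraticChar_isQuadratic F x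
  have hlow : (2 ^ K * T.card : ℤ) ≤
      ∑ y : F, ∏ i ∈ Finset.Icc 1 K, (1 + ε i * χ ((polyIter f i).eval y)) := by
    have e1 : ∀ y ∈ T, ∏ i ∈ Finset.Icc 1 K, (1 + ε i * χ ((polyIter f i).eval y)) = 2 ^ K := by
      intro y hy
      rw [Finset.prod_congr rfl (g := fun _ => (2 : ℤ))]
      · simp
      · intro i hi
        rw [hT y hy i hi]
        rcases hε i hi with h | h <;> rw [h] <;> norm_num
    calc (2 ^ K * T.card : ℤ) = ∑ y ∈ T, 2 ^ K := by simp [mul_comm]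
      _ = ∑ y ∈ T, ∏ i ∈ Finset.Icc 1 K, (1 + ε i * χ ((polyIter f i).eval y)) :=
        (Finset.sum_congr rfl e1).symm
      _ ≤ _ := by
        refine Finset.sum_le_sum_of_subset_of_nonneg (Finset.subset_univ _) ?_
        intro y _ _
        refine Finset.prod_nonneg ?_
        intro i hi
        rcases hε i hi with h | h <;> rcases hχ ((polyIter f i).eval y) with h' | h' | h' <;>
          rw [h, h'] <;> norm_num
  have hexp : ∑ y : F, ∏ i ∈ Finset.Icc 1 K, (1 + ε i * χ ((polyIter f i).eval y)) =
      ∑ S ∈ (Finset.Icc 1 K).powerset, (∏ i ∈ S, ε i) *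
        ∑ y : F, χ ((∏ i ∈ S, polyIter f i).eval y) := by
    simp_rw [Finset.prod_one_add]
    rw [Finset.sum_comm]
    refine Finset.sum_congr rfl ?_
    intro S _
    rw [Finset.mul_sum]
    refine Finset.sum_congr rfl ?_
    intro y _
    rw [Finset.prod_mul_distrib, eval_prod, map_prod]
  rw [hexp] at hlow
  have hR : (2 ^ K * T.card : ℝ) ≤ ∑ S ∈ (Finset.Icc 1 K).powerset, ((∏ i ∈ S, ε i : ℤ) : ℝ) *
        ((∑ y : F, χ ((∏ i ∈ S, polyIter f i).eval y) : ℤ) : ℝ) := by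
    exact_mod_cast hlow
  rw [← Finset.add_sum_erase _ _ (Finset.empty_mem_powerset _)] at hR
  have hb : ∀ S ∈ (Finset.Icc 1 K).powerset.erase ∅, ((∏ i ∈ S, ε i : ℤ) : ℝ) *
        ((∑ y : F, χ ((∏ i ∈ S, polyIter f i).eval y) : ℤ) : ℝ) ≤
        58 * (f.natDegree : ℝ) ^ K * √(Fintype.card F : ℝ) := by
    intro S hS
    rw [Finset.mem_erase, Finset.mem_powerset] at hS
    obtain ⟨hne, hS⟩ := hS
    have hne := Finset.nonempty_iff_ne_empty.2 hne
    have hnz : ∀ i, polyIter f i ≠ 0 := by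
      intro i hz
      have := iter_deg f i
      rw [hz, natDegree_zero] at this
      have : 0 < f.natDegree ^ i := by positivity
      omega
    have hdeg : (∏ i ∈ S, polyIter f i).natDegree = ∑ i ∈ S, f.natDegree ^ i := by
      rw [natDegree_prod _ _ fun i _ => hnz i]
      exact Finset.sum_congr rfl fun i _ => iter_deg f i
    have hdeg1 : (∏ i ∈ S, polyIter f i).natDegree ≤ 2 * f.natDegree ^ K := by
      rw [hdeg]
      exact (Finset.sum_le_sum_of_subset hS).trans (geom_sum_le_aux _ _ hd)
    have hdeg2 : 1 ≤ (∏ i ∈ S, polyIter f i).natDegree := by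
      rw [hdeg]
      exact Nat.succ_le_of_lt (Finset.sum_pos (fun i _ => by positivity) hne)
    have hw := weil hq _ hdeg2 (nonsq f (by omega) hf K S hS hne)
    have hp : |((∏ i ∈ S, ε i : ℤ) : ℝ)| = 1 := by
      push_cast
      rw [Finset.abs_prod]
      refine Finset.prod_eq_one ?_
      intro i hi
      rcases hε i (hS hi) with h | h <;> rw [h] <;> norm_num
    refine (le_abs_self _).trans ?_
    rw [abs_mul, hp, one_mul]
    refine hw.trans ?_
    have : ((∏ i ∈ S, polyIter f i).natDegree : ℝ) ≤ 2 * (f.natDegree : ℝ) ^ K := by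
      exact_mod_cast hdeg1
    have := mul_le_mul_of_nonneg_right this (by positivity : 0 ≤ √(Fintype.card F : ℝ))
    linarith
  have hsum := Finset.sum_le_sum hb
  rw [Finset.sum_const, nsmul_eq_mul] at hsum
  have hcard : ((((Finset.Icc 1 K).powerset.erase ∅).card : ℕ) : ℝ) ≤ 2 ^ K := by
    have : ((Finset.Icc 1 K).powerset.erase ∅).card ≤ 2 ^ K := by
      refine (Finset.card_erase_le).trans ?_
      simp
    exact_mod_cast this
  have hB : 0 ≤ 58 * (f.natDegree : ℝ) ^ K * √(Fintype.card F : ℝ) := by positivity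
  have hsum2 := hsum.trans (mul_le_mul_of_nonneg_right hcard hB)
  have hempty : ((∏ i ∈ (∅ : Finset ℕ), ε i : ℤ) : ℝ) *
        ((∑ y : F, χ ((∏ i ∈ (∅ : Finset ℕ), polyIter f i).eval y) : ℤ) : ℝ) = Fintype.card F := by
    simp
  rw [hempty] at hR
  have h2K : (0 : ℝ) < 2 ^ K := by positivity
  have : (2 : ℝ) ^ K * T.card ≤ 2 ^ K * ((Fintype.card F : ℝ) / 2 ^ K +
      58 * (f.natDegree : ℝ) ^ K * √(Fintype.card F : ℝ)) := by
    rw [mul_add, mul_div_cancel₀ _ h2K.ne']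
    linarith
  exact le_of_mul_le_mul_left this h2K

lemma numeric (d : ℕ) (hd : 2 ≤ d) (q : ℕ) (hq : 1 ≤ q) : ∃ K : ℕ,
    (q : ℝ) / 2 ^ K + 58 * (d : ℝ) ^ K * √(q : ℝ) ≤
      60 * (q : ℝ) ^ ((2 * Real.logb 2 d + 1) / (2 * Real.logb 2 d + 2)) := by
  have hd1 : (2 : ℝ) ≤ d := by exact_mod_cast hd
  have hq1 : (1 : ℝ) ≤ q := by exact_mod_cast hq
  have hq0 : (0 : ℝ) < q := by linarith
  set l := Real.logb 2 d with hl
  have hl1 : 1 ≤ l := by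
    rw [hl, Real.le_logb_iff_rpow_le (by norm_num) (by linarith)]; simpa using hd1
  have hdl : (2 : ℝ) ^ l = d := Real.rpow_logb (by norm_num) (by norm_num) (by linarith)
  set Q := Real.logb 2 q with hQ
  have hQ0 : 0 ≤ Q := Real.logb_nonneg (by norm_num) hq1
  have hqQ : (2 : ℝ) ^ Q = q := Real.rpow_logb (by norm_num) (by norm_num) hq0
  set t := Q / (2 * l + 2) with ht
  have ht0 : 0 ≤ t := by positivity
  have htQ : t * (2 * l + 2) = Q := by rw [ht]; field_simp
  refine ⟨⌊t⌋₊, ?_⟩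
  have hK1 := Nat.floor_le ht0
  have hK2 := (Nat.lt_floor_add_one t).le
  set K := ⌊t⌋₊
  have e1 : (q : ℝ) ^ ((2 * l + 1) / (2 * l + 2)) = 2 ^ (Q - t) := by
    rw [← hqQ, ← Real.rpow_mul (by norm_num)]
    congr 1
    rw [← htQ]; field_simp; ring
  have e2 : (q : ℝ) / 2 ^ K ≤ 2 * 2 ^ (Q - t) := by
    have : (q : ℝ) / 2 ^ K = 2 ^ (Q - K) := by
      rw [Real.rpow_sub (by norm_num), hqQ, Real.rpow_natCast]
    rw [this, ← Real.rpow_one_add' (by norm_num) ?_]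
    · exact Real.rpow_le_rpow_of_exponent_le (by norm_num) (by linarith)
    · have : t ≤ Q := by rw [← htQ]; nlinarith
      linarith
  have e3 : (d : ℝ) ^ K * √(q : ℝ) ≤ 2 ^ (Q - t) := by
    have : (d : ℝ) ^ K * √(q : ℝ) = 2 ^ (l * K + Q * (1 / 2)) := by
      rw [Real.rpow_add (by norm_num), Real.rpow_mul (by norm_num), hdl, Real.rpow_natCast,
        Real.rpow_mul (by norm_num), hqQ, Real.sqrt_eq_rpow]
    rw [this]
    refine Real.rpow_le_rpow_of_exponent_le (by norm_num) ?_
    nlinarith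
  rw [e1]
  linarith

theorem square_patterns_stmt13 (d : ℕ) (hd : 2 ≤ d) :
    ∃ Cst : ℝ, 0 < Cst ∧
      ∀ (F : Type) [Field F] [Fintype F], Odd (Fintype.card F) →
        ∀ f : F[X], f.natDegree = d → DynTwoOrdinary f →
          ∀ a : F, ∀ m : ℕ,
            (0 < m ∧
              (∀ ℓ : ℕ, 1 ≤ ℓ → chi (f.eval^[ℓ + m] a) = chi (f.eval^[ℓ] a)) ∧
              (∀ m' : ℕ, 0 < m' →
                (∀ ℓ : ℕ, 1 ≤ ℓ → chi (f.eval^[ℓ + m'] a) = chi (f.eval^[ℓ] a)) →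
                m ≤ m')) →
            (Set.ncard (Set.range fun n : ℕ => f.eval^[n] a) : ℝ) ≤
              Cst * m * (Fintype.card F : ℝ) ^
                ((2 * Real.logb 2 d + 1) / (2 * Real.logb 2 d + 2)) := by
  refine ⟨60, by norm_num, ?_⟩
  intro F _ _ hq f hfd hf a m ⟨hm, hper, _⟩
  classical
  obtain ⟨K, hK⟩ := numeric d hd (Fintype.card F) Fintype.card_pos
  let T : ℕ → Finset F := fun r => Finset.univ.filter fun y : F => ∀ i ∈ Finset.Icc 1 K,
        quadraticChar F ((polyIter f i).eval y) = chi (f.eval^[r + i] a)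
  have hper2 : ∀ t l : ℕ, 1 ≤ l → chi (f.eval^[l + m * t] a) = chi (f.eval^[l] a) := by
    intro t
    induction t with
    | zero => intro l _; simp
    | succ t ih =>
      intro l hl
      rw [mul_add, mul_one, ← add_assoc, hper _ (by omega), ih l hl]
  have hsub : (Set.range fun n : ℕ => f.eval^[n] a) ⊆
      (((Finset.range m).biUnion T : Finset F) : Set F) := by
    rintro _ ⟨n, rfl⟩
    simp only [Finset.coe_biUnion, Set.mem_iUnion, Finset.mem_coe, Finset.mem_range]
    refine ⟨n % m, Nat.mod_lt _ hm, ?_⟩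
    simp only [T, Finset.mem_filter, Finset.mem_univ, true_and]
    intro i hi
    have hi1 := (Finset.mem_Icc.1 hi).1
    rw [← chi_eq, iter_eval]
    have e1 : (fun x => f.eval x)^[i] (f.eval^[n] a) = f.eval^[i + n] a := by
      rw [Function.iterate_add_apply]
    have e2 : chi ((fun x => f.eval x)^[i] ((fun x => f.eval x)^[n] a)) =
        chi ((fun x => f.eval x)^[n % m + i] a) := by
      rw [← Function.iterate_add_apply]
      have := hper2 (n / m) (n % m + i) (by omega)
      rw [← this]
      have h5 : i + n = n % m + i + m * (n / m) := by
        have := Nat.mod_add_div n m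
        omega
      rw [h5]
    exact e2
  have h1 := (Set.ncard_le_ncard hsub (Finset.finite_toSet _))
  rw [Set.ncard_coe_finset] at h1
  have h2 : (((Finset.range m).biUnion T).card : ℝ) ≤ ∑ r ∈ Finset.range m, ((T r).card : ℝ) := by
    exact_mod_cast Finset.card_biUnion_le
  have h3 : ∑ r ∈ Finset.range m, ((T r).card : ℝ) ≤ ∑ r ∈ Finset.range m, (60 *
      (Fintype.card F : ℝ) ^ ((2 * Real.logb 2 d + 1) / (2 * Real.logb 2 d + 2))) := by
    refine Finset.sum_le_sum ?_
    intro r _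
    refine le_trans ?_ hK
    have := pattern hq f (by omega) hf K (fun i => chi (f.eval^[r + i] a)) (T r)
      (fun y hy => by simpa only [T, Finset.mem_filter, Finset.mem_univ, true_and] using hy)
    rw [hfd] at this
    exact this
  rw [Finset.sum_const, Finset.card_range, nsmul_eq_mul] at h3
  have h1R : (Set.ncard (Set.range fun n : ℕ => f.eval^[n] a) : ℝ) ≤
    (((Finset.range m).biUnion T).card : ℝ) := by exact_mod_cast h1
  refine h1R.trans (h2.trans (h3.trans (le_of_eq ?_)))
  ring
end

section
/- Let K be a field and let f ∈ K[x] be a dynamically 2-ordinary polynomial of degree d ≥ 2. Then for every nonempty finite set T of positive integers, the product ∏_{t∈T} f^t (product of the iterates f^t over t ∈ T) is not of the form h² for any h ∈ K[x], i.e., it is not a square in K[x]. -/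
open Polynomial

theorem square_patterns_stmt15 {K : Type*} [Field K] (f : K[X]) (hd : 2 ≤ f.natDegree)
    (hf : DynTwoOrdinary f) (T : Finset ℕ) (hT : T.Nonempty) (hpos : ∀ t ∈ T, 1 ≤ t) :
    ¬ ∃ h : K[X], (∏ t ∈ T, polyIter f t) = h ^ 2 := by
  rintro ⟨h, hh⟩
  set n := T.max' hT with hn
  have hnT : n ∈ T := T.max'_mem hT
  obtain ⟨g, hg, ⟨e, he, h1, h2⟩, h3⟩ := hf n (hpos n hnT)
  have hp : Prime g := hg.prime
  have hm : emultiplicity g (polyIter f n) = e := emultiplicity_eq_coe.mpr ⟨h1, h2⟩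
  have key : emultiplicity g (∏ t ∈ T, polyIter f t) = e := by
    rw [Finset.emultiplicity_prod hp, Finset.sum_eq_single_of_mem n hnT, hm]
    intro b hb hbn
    exact emultiplicity_eq_zero.mpr (h3 b (lt_of_le_of_ne (T.le_max' b hb) hbn))
  rw [hh, emultiplicity_pow hp] at key
  cases hx : emultiplicity g h with
  | top =>
    rw [hx] at key
    simp at key
  | coe m =>
    rw [hx] at key
    have h4 : 2 * m = e := by exact_mod_cast key
    obtain ⟨k, hk⟩ := he
    omega
end
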